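/- Let B₄ carry the word length |·| with respect to the generators {a,b,c} and their inverses, let sₙ = #{x ∈ B₄ : |x| = n} be the cardinality of the sphere of radius n, and for each n let Tₙ : ℓ²(B₄) → ℓ²(B₄) be the bounded operator of left convolution by the characteristic function of the sphere {x : |x| = n}. Then (limsup_{n→∞} ‖Tₙ‖^{1/n})² = limsup_{n→∞} sₙ^{1/n}, and limsup_{n→∞} sₙ^{1/n} > 1 (equivalently, with ρ_r and ρ the respective radii of convergence of Σₙ ‖Tₙ‖ zⁿ and of the growth series Σₙ sₙ zⁿ, one has ρ_r = √ρ < 1). -/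

import Mathlib

/-- Convolution of finitely supported complex functions on a group:
`(f * g)(x) = ∑_y f(y) g(y⁻¹x)`. -/
noncomputable def conv {Γ : Type*} [Group Γ] (f g : Γ →₀ ℂ) : Γ →₀ ℂ :=
  f.sum fun y cy => g.sum fun z cz => Finsupp.single (y * z) (cy * cz)

/-- The ℓ² norm of a finitely supported complex function. -/
noncomputable def l2norm {Γ : Type*} (f : Γ →₀ ℂ) : ℝ :=
  Real.sqrt (f.sum fun _ c => ‖c‖ ^ 2)

/-- Property RD of a group with respect to a length function `ℓ`. -/
def HasPropertyRD (Γ : Type*) [Group Γ] (ℓ : Γ → ℝ) : Prop :=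
  ∃ P : Polynomial ℝ, ∀ r : ℝ, 0 ≤ r → ∀ f g : Γ →₀ ℂ,
    (∀ x : Γ, f x ≠ 0 → ℓ x ≤ r) →
    l2norm (conv f g) ≤ P.eval r * l2norm f * l2norm g

/-- The word length with respect to a generating set `S` (using `S ∪ S⁻¹`). -/
noncomputable def wordLength {Γ : Type*} [Group Γ] (S : Set Γ) (x : Γ) : ℕ :=
  sInf {n : ℕ | ∃ w : List Γ, w.length = n ∧ (∀ s ∈ w, s ∈ S ∨ s⁻¹ ∈ S) ∧ w.prod = x}

/-- The braid relations of `B₄ = ⟨a,b,c ∣ aba=bab, bcb=cbc, ac=ca⟩`. -/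
def braidRels4 : Set (FreeGroup (Fin 3)) :=
  { FreeGroup.of 0 * FreeGroup.of 1 * FreeGroup.of 0 *
      (FreeGroup.of 1 * FreeGroup.of 0 * FreeGroup.of 1)⁻¹,
    FreeGroup.of 1 * FreeGroup.of 2 * FreeGroup.of 1 *
      (FreeGroup.of 2 * FreeGroup.of 1 * FreeGroup.of 2)⁻¹,
    FreeGroup.of 0 * FreeGroup.of 2 * (FreeGroup.of 2 * FreeGroup.of 0)⁻¹ }

/-- The braid group on 4 strings. -/
abbrev B4 : Type := PresentedGroup braidRels4

def a : B4 := PresentedGroup.of 0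
def b : B4 := PresentedGroup.of 1
def c : B4 := PresentedGroup.of 2

open scoped ENNReal

/-- The generating set `{a,b,c}` of `B₄`. -/
def SB4 : Set B4 := {a, b, c}

/-- The cardinality of the sphere of radius `n` in `B₄` for the word length with
respect to `{a,b,c}`. -/
noncomputable def sphereCard (n : ℕ) : ℕ :=
  Nat.card {x : B4 // wordLength SB4 x = n}

/-- A lattice with a shift: an order-preserving action of `ℤ` whose positive elements are
order units, together with a strictly increasing integer rank raised by `3` by the shift. -/
class ShiftLattice (X : Type*) extends Lattice X where
  sh : X → ℤ → X
  len : X → ℤ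
  sh_zero : ∀ x, sh x 0 = x
  sh_sh : ∀ x s t, sh (sh x s) t = sh x (s + t)
  sh_mono : ∀ x y t, x ≤ y → sh x t ≤ sh y t
  le_sh_one : ∀ x, x ≤ sh x 1
  len_sh : ∀ x t, len (sh x t) = len x + 3 * t
  len_lt : ∀ x y, x < y → len x < len y
  eq_of_inf_sh : ∀ u w, u ≤ w → w ⊓ sh u 1 = u → w = u
  exists_le_sh : ∀ x y, ∃ n : ℤ, x ≤ sh y n

namespace ShiftLattice

variable {X : Type*} [ShiftLattice X]

lemma sh_le_sh {x y : X} {t : ℤ} : sh x t ≤ sh y t ↔ x ≤ y := by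
  refine ⟨fun h => ?_, sh_mono x y t⟩
  have := sh_mono _ _ (-t) h
  simpa [sh_sh, sh_zero] using this

lemma len_mono {x y : X} (h : x ≤ y) : len x ≤ len y := by
  rcases h.eq_or_lt with rfl | h
  · rfl
  · exact (len_lt _ _ h).le

lemma eq_of_le_of_len_le {x y : X} (h : x ≤ y) (h2 : len y ≤ len x) : x = y := by
  rcases h.eq_or_lt with rfl | h
  · rfl
  · exact absurd (len_lt _ _ h) (not_lt.2 h2)

lemma le_sh_nat (x : X) (n : ℕ) : x ≤ sh x n := by
  induction n with
  | zero => simp [sh_zero]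
  | succ n ih =>
    refine ih.trans ((le_sh_one _).trans ?_)
    rw [sh_sh]; push_cast; rfl

lemma sh_le_sh_right (x : X) {s t : ℤ} (h : s ≤ t) : sh x s ≤ sh x t := by
  obtain ⟨n, hn⟩ := Int.eq_ofNat_of_zero_le (sub_nonneg.2 h)
  have := le_sh_nat (sh x s) n
  rwa [sh_sh, ← hn, add_sub_cancel] at this

lemma sh_inf (x y : X) (t : ℤ) : sh (x ⊓ y) t = sh x t ⊓ sh y t := by
  apply le_antisymm
  · exact le_inf (sh_le_sh.2 inf_le_left) (sh_le_sh.2 inf_le_right)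
  · rw [← sh_le_sh (t := -t), sh_sh, add_neg_cancel, sh_zero]
    refine le_inf ?_ ?_
    · rw [← sh_le_sh (t := t), sh_sh, neg_add_cancel, sh_zero]; exact inf_le_left
    · rw [← sh_le_sh (t := t), sh_sh, neg_add_cancel, sh_zero]; exact inf_le_right

lemma sh_sup (x y : X) (t : ℤ) : sh (x ⊔ y) t = sh x t ⊔ sh y t := by
  apply le_antisymm
  · rw [← sh_le_sh (t := -t), sh_sh, add_neg_cancel, sh_zero]
    refine sup_le ?_ ?_
    · rw [← sh_le_sh (t := t), sh_sh, neg_add_cancel, sh_zero]; exact le_sup_left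
    · rw [← sh_le_sh (t := t), sh_sh, neg_add_cancel, sh_zero]; exact le_sup_right
  · exact sup_le (sh_le_sh.2 le_sup_left) (sh_le_sh.2 le_sup_right)

lemma exists_level (x y : X) : ∃ t : ℤ, ∀ s, x ≤ sh y s ↔ t ≤ s := by
  obtain ⟨t, ht, h⟩ := Int.exists_least_of_bdd (P := fun s => x ≤ sh y s)
    ⟨-|len x| - |len y|, fun s hs => by
      have := len_mono hs
      rw [len_sh] at this
      have h1 := le_abs_self (len y)
      have h2 := neg_abs_le (len x)
      have h3 := abs_nonneg (len y)
      have h4 := abs_nonneg (len x)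
      omega⟩ (exists_le_sh x y)
  exact ⟨t, fun s => ⟨h s, fun hs => ht.trans (sh_le_sh_right y hs)⟩⟩

/-- The least shift of `y` lying above `x`. -/
noncomputable def lev (x y : X) : ℤ := (exists_level x y).choose

lemma le_sh_iff {x y : X} {s : ℤ} : x ≤ sh y s ↔ lev x y ≤ s :=
  (exists_level x y).choose_spec s

lemma sh_le_sh_iff {x y : X} {s t : ℤ} : sh x t ≤ sh y s ↔ lev x y + t ≤ s := by
  rw [← sh_le_sh (t := -t), sh_sh, sh_sh, add_neg_cancel, sh_zero, le_sh_iff]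
  constructor <;> intro <;> omega

lemma sh_le_iff {x y : X} {t : ℤ} : sh x t ≤ y ↔ lev x y + t ≤ 0 := by
  conv_lhs => rw [← sh_zero y]
  exact sh_le_sh_iff

lemma lev_triangle (x y z : X) : lev x z ≤ lev x y + lev y z := by
  rw [← le_sh_iff]
  refine (le_sh_iff.2 le_rfl : x ≤ sh y (lev x y)).trans ?_
  rw [sh_le_sh_iff]; omega

lemma lev_self (x : X) : lev x x = 0 := by
  apply le_antisymm
  · rw [← le_sh_iff, sh_zero]
  · have h := len_mono (le_sh_iff.2 le_rfl : x ≤ sh x (lev x x))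
    rw [len_sh] at h
    omega

lemma len_le_of_lev (x y : X) : len x ≤ len y + 3 * lev x y := by
  have h := len_mono (le_sh_iff.2 le_rfl : x ≤ sh y (lev x y))
  rwa [len_sh] at h

/-- The interval from `x` to `e` is a chain. -/
def ChainTo (x e : X) : Prop :=
  ∀ v w, x ≤ v → v ≤ e → x ≤ w → w ≤ e → v ≤ w ∨ w ≤ v

lemma ChainTo.mono {x y d e : X} (h : ChainTo x e) (hx : x ≤ y) (he : d ≤ e) : ChainTo y d :=
  fun v w h1 h2 h3 h4 => h v w (hx.trans h1) (h2.trans he) (hx.trans h3) (h4.trans he)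

lemma chainTo_of_le {x e : X} (h : e ≤ x) : ChainTo x e :=
  fun _ _ _ h2 h3 _ => Or.inl ((h2.trans h).trans h3)

lemma ChainTo.sh {x e : X} (h : ChainTo x e) (t : ℤ) : ChainTo (sh x t) (sh e t) := by
  intro v w h1 h2 h3 h4
  have key : ∀ v : X, v = ShiftLattice.sh (ShiftLattice.sh v (-t)) t := fun v => by
    rw [sh_sh, neg_add_cancel, sh_zero]
  rw [key v, sh_le_sh] at h1 h2
  rw [key w, sh_le_sh] at h3 h4
  rcases h _ _ h1 h2 h3 h4 with h | h
  · left; rw [key v, key w]; exact sh_le_sh.2 h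
  · right; rw [key v, key w]; exact sh_le_sh.2 h

lemma ChainTo.eq_of_len_eq {x e v w : X} (h : ChainTo x e) (h1 : x ≤ v) (h2 : v ≤ e)
    (h3 : x ≤ w) (h4 : w ≤ e) (hl : len v = len w) : v = w := by
  rcases h v w h1 h2 h3 h4 with h | h
  · exact eq_of_le_of_len_le h hl.ge
  · exact (eq_of_le_of_len_le h hl.le).symm

lemma chainTo_inf_of_heads_ne {Y Z : X} (n : ℕ) : ∀ u : X, len Y - len u ≤ n → u ≤ Y → u ≤ Z →
    Y ⊓ sh u 1 ≠ Z ⊓ sh u 1 → ¬ sh u 1 ≤ Y → ¬ sh u 1 ≤ Z → ChainTo u (Y ⊓ Z) := by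
  induction n with
  | zero =>
    intro u hn hY hZ _ _ _
    have : u = Y := eq_of_le_of_len_le hY (by push_cast at hn; omega)
    exact chainTo_of_le (this ▸ inf_le_left)
  | succ n ih =>
    intro u hn hY hZ hne hnY hnZ
    set u1 := Y ⊓ Z ⊓ sh u 1 with hu1
    have hu : u ≤ u1 := le_inf (le_inf hY hZ) (le_sh_one u)
    have hl : ∀ W : X, ¬ sh u 1 ≤ W → len (W ⊓ sh u 1) ≤ len u + 2 := by
      intro W hW
      have h1 : W ⊓ sh u 1 < sh u 1 := by
        refine lt_of_le_of_ne inf_le_right fun h => hW ?_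
        rw [← h]; exact inf_le_left
      have := len_lt _ _ h1
      rw [len_sh] at this
      omega
    have h1Y : u1 ≤ Y ⊓ sh u 1 := le_inf (inf_le_left.trans inf_le_left) inf_le_right
    have h1Z : u1 ≤ Z ⊓ sh u 1 := le_inf (inf_le_left.trans inf_le_right) inf_le_right
    have hlen : len u1 ≤ len u + 1 := by
      by_contra hcon
      apply hne
      rw [← eq_of_le_of_len_le h1Y (by have := hl Y hnY; omega),
        ← eq_of_le_of_len_le h1Z (by have := hl Z hnZ; omega)]
    rcases hu.eq_or_lt with heq | hlt
    · exact chainTo_of_le (eq_of_inf_sh u _ (le_inf hY hZ) heq.symm).le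
    · have hlt' := len_lt _ _ hlt
      have hsh : sh u 1 ≤ sh u1 1 := sh_le_sh.2 hu
      have hch : ChainTo u1 (Y ⊓ Z) := by
        refine ih u1 (by push_cast at hn; omega) (h1Y.trans inf_le_left) (h1Z.trans inf_le_left)
          (fun h => hne ?_) (fun h => hnY (hsh.trans h)) (fun h => hnZ (hsh.trans h))
        have := congrArg (· ⊓ sh u 1) h
        simpa only [inf_assoc, inf_eq_right.2 hsh] using this
      have key : ∀ v : X, u ≤ v → v ≤ Y ⊓ Z → v = u ∨ u1 ≤ v := by
        intro v huv hv
        by_cases h : v ⊓ sh u 1 = u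
        · exact Or.inl (eq_of_inf_sh u v huv h)
        · right
          have h2 : u < v ⊓ sh u 1 := lt_of_le_of_ne (le_inf huv (le_sh_one u)) (Ne.symm h)
          have h3 : v ⊓ sh u 1 ≤ u1 := inf_le_inf_right _ hv
          have h4 := len_lt _ _ h2
          rw [← eq_of_le_of_len_le h3 (by omega)]
          exact inf_le_left
      intro v w h1 h2 h3 h4
      rcases key v h1 h2 with rfl | hv
      · exact Or.inl h3
      rcases key w h3 h4 with rfl | hw
      · exact Or.inr h1
      exact hch v w hv h2 hw h4

/-- The meet of the least shifts of `y` and `z` above `x` spans a chain from `x`. -/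
def ChainAt (x y z : X) : Prop := ChainTo x (sh y (lev x y) ⊓ sh z (lev x z))

lemma ChainAt.symm {x y z : X} (h : ChainAt x y z) : ChainAt x z y := by
  unfold ChainAt; rw [inf_comm]; exact h

lemma ChainAt.inf_sh {x y z : X} (h : ChainAt x y z) (t : ℤ) : ChainAt x (y ⊓ sh x t) z := by
  by_cases hb : t + lev x (y ⊓ sh x t) ≤ 0
  · refine chainTo_of_le (inf_le_left.trans ?_)
    rw [sh_inf, sh_sh]
    refine inf_le_right.trans ?_
    rw [sh_le_iff, lev_self]; omega
  · refine ChainTo.mono h le_rfl (inf_le_inf_right _ ?_)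
    rw [sh_inf]
    refine inf_le_left.trans (sh_le_sh_right _ ?_)
    by_contra hcon
    have : x ≤ sh (y ⊓ sh x t) (lev x (y ⊓ sh x t) - 1) := by
      rw [sh_inf, sh_sh]
      refine le_inf ?_ ?_
      · rw [le_sh_iff]; omega
      · rw [le_sh_iff, lev_self]; omega
    rw [le_sh_iff] at this
    omega

lemma exists_chainAt_aux (x y z : X) (n : ℕ) : ∀ (k : ℕ) (u : X),
    u = x ⊓ sh y (lev x y - k) → u = x ⊓ sh z (lev x z - k) →
    lev u y = lev x y - k → lev u z = lev x z - k → sh x (-k) ≤ u →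
    len y + 3 * (lev x y - k) - len u ≤ n →
    ∃ k' : ℕ, k' ≤ k + n ∧ x ⊓ sh y (lev x y - k') = x ⊓ sh z (lev x z - k') ∧
      sh x (-k') ≤ x ⊓ sh y (lev x y - k') ∧ ChainAt (x ⊓ sh y (lev x y - k')) y z := by
  induction n with
  | zero =>
    intro k u hy hz ly lz hx hn
    refine ⟨k, le_rfl, hy ▸ hz, hy ▸ hx, ?_⟩
    rw [← hy, ChainAt]
    refine chainTo_of_le (inf_le_left.trans (eq_of_le_of_len_le (le_sh_iff.2 le_rfl) ?_).ge)
    rw [len_sh, ly]; push_cast at hn; omega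
  | succ n ih =>
    intro k u hy hz ly lz hx hn
    have huy : u ≤ sh y (lev x y - k) := by rw [le_sh_iff]; omega
    have huz : u ≤ sh z (lev x z - k) := by rw [le_sh_iff]; omega
    have hny : ¬ sh u 1 ≤ sh y (lev x y - k) := by rw [sh_le_sh_iff]; omega
    have hnz : ¬ sh u 1 ≤ sh z (lev x z - k) := by rw [sh_le_sh_iff]; omega
    by_cases hq : sh y (lev x y - k) ⊓ sh u 1 = sh z (lev x z - k) ⊓ sh u 1
    · set q := sh y (lev x y - k) ⊓ sh u 1 with hqdef
      have huq : u ≤ q := le_inf huy (le_sh_one u)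
      rcases huq.eq_or_lt with heq | hlt
      · refine ⟨k, by omega, hy ▸ hz, hy ▸ hx, ?_⟩
        rw [← hy, ChainAt, ly, lz]
        exact chainTo_of_le (inf_le_left.trans (eq_of_inf_sh u _ huy heq.symm).le)
      · have hlen := len_lt _ _ hlt
        have e1 : sh q (-1) = x ⊓ sh y (lev x y - (k + 1 : ℕ)) := by
          rw [hqdef, sh_inf, sh_sh, sh_sh, add_neg_cancel, sh_zero, hy, inf_left_comm,
            inf_eq_left.2 (sh_le_sh_right y _)]
          · push_cast; congr 2; ring
          · omega
        have e2 : sh q (-1) = x ⊓ sh z (lev x z - (k + 1 : ℕ)) := by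
          rw [hq, sh_inf, sh_sh, sh_sh, add_neg_cancel, sh_zero, hz, inf_left_comm,
            inf_eq_left.2 (sh_le_sh_right z _)]
          · push_cast; congr 2; ring
          · omega
        have hlev : ∀ w t, lev u w = t → q ≤ sh w t → lev (sh q (-1)) w = t - 1 := by
          intro w t h1 h2
          apply le_antisymm
          · rw [← le_sh_iff, sh_le_sh_iff]
            rw [le_sh_iff] at h2
            omega
          · by_contra hcon
            have h3 : sh q (-1) ≤ sh w (t - 2) := by rw [le_sh_iff]; omega
            rw [sh_le_sh_iff] at h3
            have h4 : u ≤ sh w (t - 1) := huq.trans (by rw [le_sh_iff]; omega)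
            rw [le_sh_iff] at h4
            omega
        obtain ⟨k', hk', h⟩ := ih (k + 1) (sh q (-1)) e1 e2
          (by rw [hlev y _ ly inf_le_left]; push_cast; ring)
          (by rw [hlev z _ lz (hq ▸ inf_le_left)]; push_cast; ring)
          (by
            have : sh x (-(k + 1 : ℕ)) = sh (sh x (-k)) (-1) := by
              rw [sh_sh]; congr 1; push_cast; ring
            rw [this]
            exact sh_le_sh.2 (hx.trans huq))
          (by rw [len_sh]; push_cast at hn ⊢; omega)
        exact ⟨k', by omega, h⟩
    · refine ⟨k, by omega, hy ▸ hz, hy ▸ hx, ?_⟩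
      rw [← hy, ChainAt, ly, lz]
      exact chainTo_inf_of_heads_ne (len (sh y (lev x y - k)) - len u).toNat u
        (Int.self_le_toNat _) huy huz hq hny hnz

/-- `x` and `y` are at distance at most `n`. -/
def Near (n : ℤ) (x y : X) : Prop := lev x y ≤ n ∧ lev y x ≤ n

lemma Near.symm {n : ℤ} {x y : X} (h : Near n x y) : Near n y x := And.symm h

lemma Near.trans {m n : ℤ} {x y z : X} (h : Near m x y) (h' : Near n y z) :
    Near (m + n) x z := by
  have h1 := lev_triangle x y z
  have h2 := lev_triangle z y x
  unfold Near at *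
  omega

lemma Near.mono {m n : ℤ} {x y : X} (h : Near m x y) (hmn : m ≤ n) : Near n x y :=
  ⟨h.1.trans hmn, h.2.trans hmn⟩

lemma Near.bounds {n : ℤ} {x y : X} (h : Near n x y) :
    -n ≤ lev x y ∧ lev x y ≤ n ∧ -n ≤ lev y x ∧ lev y x ≤ n ∧
      len x ≤ len y + 3 * n ∧ len y ≤ len x + 3 * n := by
  have h1 := lev_triangle x y x
  have h2 := len_le_of_lev x y
  have h3 := len_le_of_lev y x
  rw [lev_self] at h1
  unfold Near at h
  omega

lemma exists_chainAt {n : ℤ} {x y z : X} (hxy : Near n x y) (hxz : Near n x z) :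
    ∃ i j : ℤ, (-(7 * n) ≤ i ∧ i ≤ 7 * n) ∧ (-(7 * n) ≤ j ∧ j ≤ 7 * n) ∧
      x ⊓ sh y i = x ⊓ sh z j ∧ Near (6 * n) (x ⊓ sh y i) x ∧ ChainAt (x ⊓ sh y i) y z := by
  have b1 := hxy.bounds
  have b2 := hxz.bounds
  obtain ⟨k, hk, h1, h2, h3⟩ := exists_chainAt_aux x y z
    (len y + 3 * lev x y - len x).toNat 0 x
    (by rw [eq_comm, inf_eq_left, le_sh_iff]; simp) (by rw [eq_comm, inf_eq_left, le_sh_iff]; simp)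
    (by simp) (by simp) (by simp [sh_zero])
    (by push_cast; have := Int.self_le_toNat (len y + 3 * lev x y - len x); omega)
  have hk' : (k : ℤ) ≤ 6 * n := by
    have := len_le_of_lev x y
    omega
  refine ⟨lev x y - k, lev x z - k, by omega, by omega, h1, ⟨?_, ?_⟩, h3⟩
  · rw [← le_sh_iff]
    refine inf_le_left.trans ?_
    rw [le_sh_iff, lev_self]; omega
  · rw [sh_le_iff] at h2; omega

/-- Points on the canonical chains joining `x` to `y`. -/
def HullCore (n : ℤ) (x y v : X) : Prop :=
  ∃ k m w, |k| ≤ n ∧ |m| ≤ n ∧ |len w - len x| ≤ n ∧ v = sh w m ∧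
    ((sh x k ≤ w ∧ w ≤ sh x k ⊔ y ∧ ChainTo (sh x k) (sh x k ⊔ y)) ∨
      (y ≤ w ∧ w ≤ sh x k ⊔ y ∧ ChainTo y (sh x k ⊔ y)))

lemma hullCore_left {n k m : ℤ} {x y w : X} (h1 : x ≤ w) (h2 : w ≤ x ⊔ sh y k)
    (h3 : ChainTo x (x ⊔ sh y k)) (hk : |k| ≤ n) (hm : |m + k| ≤ n)
    (hw : |len w - 3 * k - len x| ≤ n) : HullCore n x y (sh w m) := by
  have e : sh (x ⊔ sh y k) (-k) = sh x (-k) ⊔ y := by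
    rw [sh_sup, sh_sh, add_neg_cancel, sh_zero]
  refine ⟨-k, m + k, sh w (-k), by rwa [abs_neg], hm, ?_, ?_, Or.inl ⟨sh_le_sh.2 h1, ?_, ?_⟩⟩
  · rw [len_sh]; convert hw using 2; ring
  · rw [sh_sh]; congr 1; ring
  · rw [← e]; exact sh_le_sh.2 h2
  · rw [← e]; exact h3.sh _

lemma hullCore_right {n k m : ℤ} {x y w : X} (h1 : y ≤ w) (h2 : w ≤ y ⊔ sh x k)
    (h3 : ChainTo y (y ⊔ sh x k)) (hk : |k| ≤ n) (hm : |m| ≤ n)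
    (hw : |len w - len x| ≤ n) : HullCore n x y (sh w m) := by
  rw [sup_comm] at h2 h3
  exact ⟨k, m, w, hk, hm, hw, rfl, Or.inr ⟨h1, h2, h3⟩⟩

lemma corner_le (x y z : X) :
    x ⊔ sh y (lev x z - lev y z) ≤ sh y (lev x y) ⊓ sh z (lev x z) := by
  have t1 := lev_triangle x y z
  have t2 := lev_self y
  refine sup_le (le_inf ?_ ?_) (le_inf ?_ ?_)
  · rw [le_sh_iff]
  · rw [le_sh_iff]
  · rw [sh_le_sh_iff]; omega
  · rw [sh_le_sh_iff]; omega

lemma corner_eq (x y z : X) : x ⊔ sh y (lev x z - lev y z) =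
    sh (y ⊔ sh x (lev y z - lev x z)) (lev x z - lev y z) := by
  rw [sh_sup, sh_sh, sup_comm, sub_add_sub_cancel, sub_self, sh_zero]

/-- The points of the triangle obtained when all three corners are chains. -/
lemma exists_center {n : ℤ} {x y z : X} (hxy : Near n x y) (hxz : Near n x z) (hyz : Near n y z)
    (cx : ChainAt x y z) (cy : ChainAt y x z) (cz : ChainAt z x y) :
    ∃ x₁ y₁ z₁ : X, HullCore (20 * n) x y x₁ ∧ HullCore (20 * n) x y y₁ ∧
      HullCore (20 * n) y z y₁ ∧ HullCore (20 * n) y z z₁ ∧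
      HullCore (20 * n) x z x₁ ∧ HullCore (20 * n) x z z₁ ∧
      ((x₁ ≤ y₁ ∧ ChainTo x₁ y₁ ∧ y₁ ≤ z₁ ∧ ChainTo y₁ z₁) ∨
        (x₁ ≤ z₁ ∧ ChainTo x₁ z₁ ∧ z₁ ≤ y₁ ∧ ChainTo z₁ y₁)) := by
  have b1 := hxy.bounds
  have b2 := hxz.bounds
  have b3 := hyz.bounds
  have t1 := lev_triangle x y z
  have t2 := lev_triangle x z y
  have t3 := lev_triangle y x z
  have t4 := lev_triangle y z x
  have t5 := lev_triangle z x y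
  have t6 := lev_triangle z y x
  have hp := corner_le x y z
  have hq := corner_le x z y
  have hp' := corner_le y x z
  have hr := corner_le y z x
  have hq' := corner_le z x y
  have hr' := corner_le z y x
  rw [inf_comm] at hq hr hr'
  unfold ChainAt at cx cy cz
  -- the shifted coincidences
  have ep := corner_eq x y z
  have eq := corner_eq x z y
  have er := corner_eq y z x
  generalize hgxy : lev x y = xy at *
  generalize hgxz : lev x z = xz at *
  generalize hgyx : lev y x = yx at *
  generalize hgyz : lev y z = yz at *
  generalize hgzx : lev z x = zx at *
  generalize hgzy : lev z y = zy at *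
  have hl : ∀ (p q w e : X) (t : ℤ), p ≤ w → w ≤ sh q t ⊓ e →
      len p ≤ len w ∧ len w ≤ len q + 3 * t :=
    fun p q w e t h1 h2 => ⟨len_mono h1, by
      have := len_mono (h2.trans inf_le_left); rwa [len_sh] at this⟩
  have lp := hl _ _ _ _ _ le_sup_left hp
  have lq := hl _ _ _ _ _ le_sup_left hq
  have lp' := hl _ _ _ _ _ le_sup_left hp'
  have lr := hl _ _ _ _ _ le_sup_left hr
  have lq' := hl _ _ _ _ _ le_sup_left hq'
  have lr' := hl _ _ _ _ _ le_sup_left hr'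
  have chp := cx.mono le_rfl hp
  have chq := cx.mono le_rfl hq
  have chp' := cy.mono le_rfl hp'
  have chr := cy.mono le_rfl hr
  have chq' := cz.mono le_rfl hq'
  have chr' := cz.mono le_rfl hr'
  have trivial_chain : ∀ v : X, (v ≤ v ∧ ChainTo v v ∧ v ≤ v ∧ ChainTo v v) := fun v =>
    ⟨le_rfl, chainTo_of_le le_rfl, le_rfl, chainTo_of_le le_rfl⟩
  have dp : _ ∨ _ := cx _ _ le_sup_left hp le_sup_left hq
  have dp' : _ ∨ _ := cy _ _ le_sup_left hp' le_sup_left hr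
  have dq' : _ ∨ _ := cz _ _ le_sup_left hq' le_sup_left hr'
  have top : ∀ (u v : X) (k : ℤ), ChainTo u (u ⊔ sh v k) → |k| ≤ 20 * n →
      |len (u ⊔ sh v k) - 3 * k - len u| ≤ 20 * n → HullCore (20 * n) u v (u ⊔ sh v k) := by
    intro u v k h1 h2 h3
    have := hullCore_left (m := 0) le_sup_left le_rfl h1 h2 (by simpa using h2) h3
    rwa [sh_zero] at this
  have pxy : HullCore (20 * n) x y (x ⊔ sh y (xz - yz)) :=
    top _ _ _ chp (by rw [abs_le]; omega) (by rw [abs_le]; omega)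
  have qxz : HullCore (20 * n) x z (x ⊔ sh z (xy - zy)) :=
    top _ _ _ chq (by rw [abs_le]; omega) (by rw [abs_le]; omega)
  have ryz : HullCore (20 * n) y z (y ⊔ sh z (yx - zx)) :=
    top _ _ _ chr (by rw [abs_le]; omega) (by rw [abs_le]; omega)
  rcases dp with dp | dp
  · have pxz : HullCore (20 * n) x z (x ⊔ sh y (xz - yz)) := by
      have := hullCore_left (m := 0) (n := 20 * n) le_sup_left dp chq
        (by rw [abs_le]; omega) (by rw [abs_le]; omega) (by rw [abs_le]; omega)
      rwa [sh_zero] at this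
    rcases dp' with dp' | dp'
    · have pyz : HullCore (20 * n) y z (x ⊔ sh y (xz - yz)) := by
        rw [ep]
        exact hullCore_left le_sup_left dp' chr
          (by rw [abs_le]; omega) (by rw [abs_le]; omega) (by rw [abs_le]; omega)
      exact ⟨_, _, _, pxy, pxy, pyz, pyz, pxz, pxz, Or.inl (trivial_chain _)⟩
    · have rxy : ∀ m : ℤ, |m| ≤ 20 * n → HullCore (20 * n) x y (sh (y ⊔ sh z (yx - zx)) m) :=
        fun m hm => hullCore_right le_sup_left dp' chp'
          (by rw [abs_le]; omega) hm (by rw [abs_le]; omega)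
      rcases dq' with dq' | dq'
      · have qyz : HullCore (20 * n) y z (x ⊔ sh z (xy - zy)) := by
          rw [eq]
          exact hullCore_right le_sup_left dq' chr'
            (by rw [abs_le]; omega) (by rw [abs_le]; omega) (by rw [abs_le]; omega)
        refine ⟨_, sh (z ⊔ sh y (zx - yx)) (xy - zy), _, pxy, ?_, ?_, qyz, pxz, qxz,
          Or.inr ⟨dp, cx.mono le_sup_left hq, ?_, ?_⟩⟩
        · have := rxy (xy - zy - (yx - zx)) (by rw [abs_le]; omega)
          rw [er, sh_sh] at this
          convert this using 2; ring
        · exact hullCore_right le_sup_left le_rfl chr'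
            (by rw [abs_le]; omega) (by rw [abs_le]; omega) (by rw [abs_le]; omega)
        · rw [eq]; exact sh_le_sh.2 dq'
        · rw [eq]; exact (cz.mono le_sup_left hr').sh _
      · have rxz : HullCore (20 * n) x z (y ⊔ sh z (yx - zx)) := by
          rw [er]
          exact hullCore_right le_sup_left dq' chq'
            (by rw [abs_le]; omega) (by rw [abs_le]; omega) (by rw [abs_le]; omega)
        have rxy' := rxy 0 (by rw [abs_le]; omega)
        rw [sh_zero] at rxy'
        exact ⟨_, _, _, rxy', rxy', ryz, ryz, rxz, rxz, Or.inl (trivial_chain _)⟩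
  · have qxy : HullCore (20 * n) x y (x ⊔ sh z (xy - zy)) := by
      have := hullCore_left (m := 0) (n := 20 * n) le_sup_left dp chp
        (by rw [abs_le]; omega) (by rw [abs_le]; omega) (by rw [abs_le]; omega)
      rwa [sh_zero] at this
    rcases dq' with dq' | dq'
    · have qyz : HullCore (20 * n) y z (x ⊔ sh z (xy - zy)) := by
        rw [eq]
        exact hullCore_right le_sup_left dq' chr'
          (by rw [abs_le]; omega) (by rw [abs_le]; omega) (by rw [abs_le]; omega)
      exact ⟨_, _, _, qxy, qxy, qyz, qyz, qxz, qxz, Or.inl (trivial_chain _)⟩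
    · have rxz : ∀ m : ℤ, |m| ≤ 20 * n → HullCore (20 * n) x z (sh (z ⊔ sh y (zx - yx)) m) :=
        fun m hm => hullCore_right le_sup_left dq' chq'
          (by rw [abs_le]; omega) hm (by rw [abs_le]; omega)
      rcases dp' with dp' | dp'
      · have pyz : HullCore (20 * n) y z (x ⊔ sh y (xz - yz)) := by
          rw [ep]
          exact hullCore_left le_sup_left dp' chr
            (by rw [abs_le]; omega) (by rw [abs_le]; omega) (by rw [abs_le]; omega)
        refine ⟨_, _, sh (y ⊔ sh z (yx - zx)) (xz - yz), qxy, pxy, pyz, ?_, qxz, ?_,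
          Or.inl ⟨dp, cx.mono le_sup_left hp, ?_, ?_⟩⟩
        · exact hullCore_left le_sup_left le_rfl chr
            (by rw [abs_le]; omega) (by rw [abs_le]; omega) (by rw [abs_le]; omega)
        · rw [er, sh_sh]
          exact rxz _ (by rw [abs_le]; omega)
        · rw [ep]; exact sh_le_sh.2 dp'
        · rw [ep]; exact (cy.mono le_sup_left hr).sh _
      · have rxz' := rxz (yx - zx) (by rw [abs_le]; omega)
        rw [← er] at rxz'
        have rxy : HullCore (20 * n) x y (sh (y ⊔ sh z (yx - zx)) 0) :=
          hullCore_right le_sup_left dp' chp'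
            (by rw [abs_le]; omega) (by rw [abs_le]; omega) (by rw [abs_le]; omega)
        rw [sh_zero] at rxy
        exact ⟨_, _, _, rxy, rxy, ryz, ryz, rxz', rxz', Or.inl (trivial_chain _)⟩

/-- Points on the canonical chains joining the truncations of `x` and `y`. -/
def Hull (n : ℤ) (x y v : X) : Prop :=
  ∃ i j, |i| ≤ n ∧ |j| ≤ n ∧ |len (x ⊓ sh y i) - len x| ≤ n ∧
    HullCore n (x ⊓ sh y i) (y ⊓ sh (x ⊓ sh y i) j) v

lemma Hull.len_bound {n : ℤ} {x y v : X} (h : Hull n x y v) : |len v - len x| ≤ 5 * n := by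
  obtain ⟨i, j, -, -, h1, k, m, w, -, hm, hw, rfl, -⟩ := h
  rw [len_sh]
  rw [abs_le] at *
  omega

theorem exists_hull_triangle {n : ℤ} {x y z : X} (hxy : Near n x y) (hxz : Near n x z)
    (hyz : Near n y z) :
    ∃ x₁ y₁ z₁ : X, Hull (6860 * n) x y x₁ ∧ Hull (6860 * n) x y y₁ ∧
      Hull (6860 * n) y z y₁ ∧ Hull (6860 * n) y z z₁ ∧
      Hull (6860 * n) x z x₁ ∧ Hull (6860 * n) x z z₁ ∧
      ((x₁ ≤ y₁ ∧ ChainTo x₁ y₁ ∧ y₁ ≤ z₁ ∧ ChainTo y₁ z₁) ∨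
        (x₁ ≤ z₁ ∧ ChainTo x₁ z₁ ∧ z₁ ≤ y₁ ∧ ChainTo z₁ y₁)) := by
  have hn := hxy.bounds
  obtain ⟨i, i', hi, hi', ex, nx, cx⟩ := exists_chainAt hxy hxz
  set x' := x ⊓ sh y i with hx'
  have nxy : Near (7 * n) x' y := (nx.trans hxy).mono (by omega)
  have nxz : Near (7 * n) x' z := (nx.trans hxz).mono (by omega)
  obtain ⟨j, j', hj, hj', ey, ny, cy⟩ :=
    exists_chainAt nxy.symm (hyz.mono (by omega : n ≤ 7 * n))
  set y' := y ⊓ sh x' j with hy'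
  have nxy' : Near (49 * n) x' y' := (nxy.trans ny.symm).mono (by omega)
  have nyz' : Near (49 * n) y' z := (ny.trans hyz).mono (by omega)
  have cx' : ChainAt x' y' z := cx.inf_sh j
  obtain ⟨k, k', hk, hk', ez, nz, cz⟩ :=
    exists_chainAt (nxz.symm.mono (by omega : 7 * n ≤ 49 * n)) nyz'.symm
  set z' := z ⊓ sh x' k with hz'
  have bx := nx.bounds
  have by' := ny.bounds
  obtain ⟨x₁, y₁, z₁, h1, h2, h3, h4, h5, h6, h7⟩ :=
    exists_center (n := 343 * n) (nxy'.mono (by omega))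
      ((nxz.trans nz.symm).mono (by omega)) ((nyz'.trans nz.symm).mono (by omega))
      (cx'.symm.inf_sh k).symm (by rw [ez]; exact (cy.symm.inf_sh k').symm) cz
  have e : 20 * (343 * n) = 6860 * n := by ring
  rw [e] at h1 h2 h3 h4 h5 h6
  have hXY : ∀ v, HullCore (6860 * n) x' y' v → Hull (6860 * n) x y v := fun v hv =>
    ⟨i, j, by rw [abs_le]; omega, by rw [abs_le]; omega, by rw [← hx', abs_le]; omega, hv⟩
  have hXZ : ∀ v, HullCore (6860 * n) x' z' v → Hull (6860 * n) x z v := fun v hv =>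
    ⟨i', k, by rw [abs_le]; omega, by rw [abs_le]; omega, by rw [← ex, abs_le]; omega,
      by rw [← ex]; exact hv⟩
  have hYZ : ∀ v, HullCore (6860 * n) y' z' v → Hull (6860 * n) y z v := fun v hv =>
    ⟨j', k', by rw [abs_le]; omega, by rw [abs_le]; omega, by rw [← ey, abs_le]; omega,
      by rw [← ey, ← ez]; exact hv⟩
  exact ⟨x₁, y₁, z₁, hXY _ h1, hXY _ h2, hYZ _ h3, hYZ _ h4, hXZ _ h5, hXZ _ h6, h7⟩

lemma encard_hull_le (n : ℕ) (x y : X) :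
    {v | Hull n x y v}.encard ≤ ((2 * (2 * n + 1) ^ 5 : ℕ) : ℕ∞) := by
  classical
  set I : Finset ℤ := Finset.Icc (-n : ℤ) n with hI
  set B : Finset (Bool × ℤ × ℤ × ℤ × ℤ × ℤ) := Finset.univ ×ˢ I ×ˢ I ×ˢ I ×ˢ I ×ˢ I with hB
  let good : X → Bool × ℤ × ℤ × ℤ × ℤ × ℤ → Prop := fun v p =>
    ∃ w, v = sh w p.2.2.2.2.1 ∧ len w - len (x ⊓ sh y p.2.1) = p.2.2.2.2.2 ∧
      let x' := x ⊓ sh y p.2.1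
      let y' := y ⊓ sh x' p.2.2.1
      let u := sh x' p.2.2.2.1
      let s := if p.1 then u else y'
      s ≤ w ∧ w ≤ u ⊔ y' ∧ ChainTo s (u ⊔ y')
  have hex : ∀ v ∈ {v | Hull n x y v}, ∃ p ∈ B, good v p := by
    rintro v ⟨i, j, hi, hj, -, k, m, w, hk, hm, hw, rfl, h⟩
    have mem : ∀ t : ℤ, |t| ≤ n → t ∈ I := fun t ht => by
      rw [hI, Finset.mem_Icc]; exact abs_le.1 ht
    rcases h with h | h
    · exact ⟨(true, i, j, k, m, len w - len (x ⊓ sh y i)), 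
        by simp only [hB, Finset.mem_product, Finset.mem_univ, true_and]; exact
          ⟨mem _ hi, mem _ hj, mem _ hk, mem _ hm, mem _ hw⟩, w, rfl, rfl,
        by simpa using h⟩
    · exact ⟨(false, i, j, k, m, len w - len (x ⊓ sh y i)), 
        by simp only [hB, Finset.mem_product, Finset.mem_univ, true_and]; exact
          ⟨mem _ hi, mem _ hj, mem _ hk, mem _ hm, mem _ hw⟩, w, rfl, rfl,
        by simpa using h⟩
  choose! f hfB hf using hex
  have hinj : Set.InjOn f {v | Hull n x y v} := by
    intro v hv v' hv' hvv
    obtain ⟨w, hw, hl, h1, h2, h3⟩ := hf v hv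
    obtain ⟨w', hw', hl', h1', h2', -⟩ := hf v' hv'
    rw [← hvv] at hl' h1' h2' hw'
    rw [hw, hw', h3.eq_of_len_eq h1 h2 h1' h2' (by omega)]
  have hcard : B.card = 2 * (2 * n + 1) ^ 5 := by
    have : I.card = 2 * n + 1 := by rw [hI, Int.card_Icc]; omega
    simp only [hB, Finset.card_product, this, Finset.card_univ, Fintype.card_bool]; ring
  calc _ ≤ (B : Set _).encard := Set.encard_le_encard_of_injOn (fun v hv => hfB v hv) hinj
    _ = _ := by rw [Set.encard_coe_eq_coe_finsetCard, hcard]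

end ShiftLattice

/-- A group with a left-invariant shift lattice structure, such as a Garside group. -/
class GarsideGroup (G : Type*) extends Group G, ShiftLattice G where
  mul_mono : ∀ g x y : G, x ≤ y → g * x ≤ g * y
  mul_sh : ∀ (g x : G) (t : ℤ), g * sh x t = sh (g * x) t
  len_mul : ∀ g h : G, len (g * h) = len g + len h

namespace GarsideGroup

open ShiftLattice

variable {G : Type*} [GarsideGroup G]

lemma mul_le_mul_iff {g x y : G} : g * x ≤ g * y ↔ x ≤ y := by
  refine ⟨fun h => ?_, mul_mono g x y⟩
  simpa using mul_mono g⁻¹ _ _ h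

lemma mul_inf (g x y : G) : g * (x ⊓ y) = g * x ⊓ g * y := by
  apply le_antisymm
  · exact le_inf (mul_mono _ _ _ inf_le_left) (mul_mono _ _ _ inf_le_right)
  · rw [← mul_le_mul_iff (g := g⁻¹), inv_mul_cancel_left]
    refine le_inf ?_ ?_
    · rw [← mul_le_mul_iff (g := g), mul_inv_cancel_left]; exact inf_le_left
    · rw [← mul_le_mul_iff (g := g), mul_inv_cancel_left]; exact inf_le_right

lemma mul_sup (g x y : G) : g * (x ⊔ y) = g * x ⊔ g * y := by
  apply le_antisymm
  · rw [← mul_le_mul_iff (g := g⁻¹), inv_mul_cancel_left]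
    refine sup_le ?_ ?_
    · rw [← mul_le_mul_iff (g := g), mul_inv_cancel_left]; exact le_sup_left
    · rw [← mul_le_mul_iff (g := g), mul_inv_cancel_left]; exact le_sup_right
  · exact sup_le (mul_mono _ _ _ le_sup_left) (mul_mono _ _ _ le_sup_right)

lemma len_one : len (1 : G) = 0 := by
  have := len_mul (1 : G) 1
  rw [mul_one] at this; omega

lemma len_inv (g : G) : len g⁻¹ = -len g := by
  have := len_mul g g⁻¹
  rw [mul_inv_cancel, len_one] at this; omega

lemma chainTo_mul {g x e : G} (h : ChainTo x e) : ChainTo (g * x) (g * e) := by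
  intro v w h1 h2 h3 h4
  have key : ∀ v : G, v = g * (g⁻¹ * v) := fun v => by group
  rw [key v, mul_le_mul_iff] at h1 h2
  rw [key w, mul_le_mul_iff] at h3 h4
  rcases h _ _ h1 h2 h3 h4 with h | h
  · left; rw [key v, key w]; exact mul_mono _ _ _ h
  · right; rw [key v, key w]; exact mul_mono _ _ _ h

lemma hull_mul {n : ℤ} {g x y v : G} (h : Hull n x y v) : Hull n (g * x) (g * y) (g * v) := by
  obtain ⟨i, j, hi, hj, hl, k, m, w, hk, hm, hw, rfl, h⟩ := h
  refine ⟨i, j, hi, hj, ?_, k, m, g * w, hk, hm, ?_, mul_sh _ _ _, ?_⟩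
  · simp only [← mul_sh, ← mul_inf, len_mul]; convert hl using 2; ring
  · simp only [← mul_sh, ← mul_inf, len_mul]; convert hw using 2; ring
  · simp only [← mul_sh, ← mul_inf, ← mul_sup, mul_le_mul_iff]
    exact h.imp (fun h => ⟨h.1, h.2.1, chainTo_mul h.2.2⟩)
      (fun h => ⟨h.1, h.2.1, chainTo_mul h.2.2⟩)

lemma hull_mul_iff {n : ℤ} {g x y v : G} : Hull n (g * x) (g * y) (g * v) ↔ Hull n x y v :=
  ⟨fun h => by simpa using hull_mul (g := g⁻¹) h, hull_mul⟩

lemma lev_mul (g x y : G) : lev (g * x) (g * y) = lev x y := by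
  have key : ∀ s, lev (g * x) (g * y) ≤ s ↔ lev x y ≤ s := fun s => by
    rw [← le_sh_iff, ← le_sh_iff, ← mul_sh, mul_le_mul_iff]
  exact le_antisymm ((key _).2 le_rfl) ((key _).1 le_rfl)

lemma near_mul_iff {n : ℤ} {g x y : G} : Near n (g * x) (g * y) ↔ Near n x y := by
  unfold Near; rw [lev_mul, lev_mul]

/-- Elements of `G` of rank at most `K` whose interval from `1` is a chain. -/
def chainSet (G : Type*) [GarsideGroup G] (K : ℕ) : Set G :=
  {g | 1 ≤ g ∧ ChainTo 1 g ∧ len g ≤ K}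

lemma inv_mul_mem_chainSet {K : ℕ} {x y : G} (h : x ≤ y) (hc : ChainTo x y)
    (hl : len y - len x ≤ K) : x⁻¹ * y ∈ chainSet G K := by
  refine ⟨?_, ?_, ?_⟩
  · rw [← mul_le_mul_iff (g := x)]; simpa using h
  · have := chainTo_mul (g := x⁻¹) hc
    rwa [inv_mul_cancel] at this
  · rw [len_mul, len_inv]; omega

/-- The conclusion of the combinatorial part: every product `s * t` of two elements of a ball
reduces, through hull points of the three sides, to a product of elements of `chainSet`. -/
theorem exists_reduction (n : ℕ) (s t : G) (hs : Near n 1 s) (ht : Near n 1 t)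
    (hst : Near n 1 (s * t)) :
    ∃ p q r : G, Hull (6860 * n) 1 s p ∧ Hull (6860 * n) 1 s (s * q) ∧
      Hull (6860 * n) 1 t q ∧ Hull (6860 * n) 1 t (t * r) ∧
      Hull (6860 * n) 1 (s * t) p ∧ Hull (6860 * n) 1 (s * t) (s * t * r) ∧
      ((p⁻¹ * s * q ∈ chainSet G (68600 * n) ∧ q⁻¹ * t * r ∈ chainSet G (68600 * n)) ∨
        (p⁻¹ * (s * t) * r ∈ chainSet G (68600 * n) ∧
          (q⁻¹ * t * r)⁻¹ ∈ chainSet G (68600 * n))) := by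
  have hyz : Near n s (s * t) := by
    rw [← near_mul_iff (g := s), mul_one] at ht; exact ht
  obtain ⟨x₁, y₁, z₁, h1, h2, h3, h4, h5, h6, h7⟩ := exists_hull_triangle hs hst hyz
  have b1 := h1.len_bound
  have b2 := h2.len_bound
  have b5 := h5.len_bound
  have b6 := h6.len_bound
  have b3 := h3.len_bound
  have b4 := h4.len_bound
  rw [abs_le] at b1 b2 b3 b4 b5 b6
  refine ⟨x₁, s⁻¹ * y₁, (s * t)⁻¹ * z₁, h1, by simpa using h2, ?_, ?_, h5,
    by rwa [mul_inv_cancel_left], ?_⟩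
  · rw [← hull_mul_iff (g := s)]; simpa using h3
  · rw [← hull_mul_iff (g := s)]; simpa [mul_assoc] using h4
  · rcases h7 with ⟨h, hc, h', hc'⟩ | ⟨h, hc, h', hc'⟩
    · left
      refine ⟨?_, ?_⟩
      · convert inv_mul_mem_chainSet h hc _ using 1
        · group
        · push_cast; omega
      · convert inv_mul_mem_chainSet h' hc' _ using 1
        · group
        · push_cast; omega
    · right
      refine ⟨?_, ?_⟩
      · convert inv_mul_mem_chainSet h hc _ using 1
        · group
        · push_cast; omega
      · convert inv_mul_mem_chainSet h' hc' _ using 1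
        · group
        · push_cast; omega

end GarsideGroup

namespace ENNReal

lemma two_mul_mul_le_sq_add_sq (x y : ℝ≥0∞) : 2 * (x * y) ≤ x ^ 2 + y ^ 2 := by
  rcases le_total x y with h | h
  · obtain ⟨d, rfl⟩ := exists_add_of_le h
    calc 2 * (x * (x + d)) ≤ 2 * (x * (x + d)) + d ^ 2 := le_self_add
      _ = _ := by ring
  · obtain ⟨d, rfl⟩ := exists_add_of_le h
    calc 2 * ((y + d) * y) ≤ 2 * ((y + d) * y) + d ^ 2 := le_self_add
      _ = _ := by ring

lemma tsum_mul_sq_le {ι : Type*} (f g : ι → ℝ≥0∞) :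
    (∑' i, f i * g i) ^ 2 ≤ (∑' i, f i ^ 2) * ∑' i, g i ^ 2 := by
  have h2 : 2 * (∑' i, f i * g i) ^ 2 ≤ 2 * ((∑' i, f i ^ 2) * ∑' i, g i ^ 2) := by
    calc 2 * (∑' i, f i * g i) ^ 2
        = ∑' i, ∑' j, 2 * ((f i * g j) * (f j * g i)) := by
          rw [sq, ← ENNReal.tsum_mul_right, ← ENNReal.tsum_mul_left]
          refine tsum_congr fun i => ?_
          rw [← ENNReal.tsum_mul_left, ← ENNReal.tsum_mul_left]
          exact tsum_congr fun j => by ring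
      _ ≤ ∑' i, ∑' j, ((f i * g j) ^ 2 + (f j * g i) ^ 2) :=
          ENNReal.tsum_le_tsum fun i => ENNReal.tsum_le_tsum fun j => two_mul_mul_le_sq_add_sq _ _
      _ = (∑' i, ∑' j, (f i * g j) ^ 2) + ∑' i, ∑' j, (f j * g i) ^ 2 := by
          rw [← ENNReal.tsum_add]
          exact tsum_congr fun i => ENNReal.tsum_add
      _ = (∑' i, ∑' j, (f i * g j) ^ 2) + ∑' i, ∑' j, (f i * g j) ^ 2 := by
          congr 1; rw [ENNReal.tsum_comm]
      _ = _ := by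
          rw [← two_mul, ← ENNReal.tsum_mul_right]
          congr 1
          refine tsum_congr fun i => ?_
          rw [← ENNReal.tsum_mul_left]
          exact tsum_congr fun j => by ring
  exact (ENNReal.mul_le_mul_iff_right (by simp) (by simp)).1 h2

lemma sum_sq_le {ι : Type*} (s : Finset ι) (f : ι → ℝ≥0∞) :
    (∑ i ∈ s, f i) ^ 2 ≤ s.card * ∑ i ∈ s, f i ^ 2 := by
  have := tsum_mul_sq_le (fun _ : s => (1 : ℝ≥0∞)) (fun i => f i)
  rw [tsum_fintype, tsum_fintype, tsum_fintype, Finset.sum_coe_sort s (fun i => 1 * f i),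
    Finset.sum_coe_sort s (fun i => f i ^ 2)] at this
  simpa using this

lemma le_of_sq_le_sq {x y : ℝ≥0∞} (h : x ^ 2 ≤ y ^ 2) : x ≤ y := by
  by_contra hlt
  exact absurd h (not_le.2 (ENNReal.pow_lt_pow_left two_ne_zero (not_le.1 hlt)))

/-- The squared Hilbert–Schmidt estimate for a triangle of kernels. -/
lemma tsum_triangle_sq_le {ι κ μ : Type*} (f : ι → κ → ℝ≥0∞) (g : κ → μ → ℝ≥0∞)
    (h : ι → μ → ℝ≥0∞) :
    (∑' i, ∑' j, ∑' k, f i j * g j k * h i k) ^ 2 ≤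
      (∑' i, ∑' j, f i j ^ 2) * (∑' j, ∑' k, g j k ^ 2) * ∑' i, ∑' k, h i k ^ 2 := by
  have e : ∑' i, ∑' j, ∑' k, f i j * g j k * h i k =
      ∑' p : ι × κ, f p.1 p.2 * ∑' k, g p.2 k * h p.1 k := by
    rw [ENNReal.tsum_prod (f := fun i j => f i j * ∑' k, g j k * h i k)]
    refine tsum_congr fun i => tsum_congr fun j => ?_
    rw [← ENNReal.tsum_mul_left]
    exact tsum_congr fun k => by ring
  rw [e, mul_assoc]
  refine (tsum_mul_sq_le _ _).trans ?_
  rw [ENNReal.tsum_prod (f := fun i j => f i j ^ 2),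
    ENNReal.tsum_prod (f := fun i j => (∑' k, g j k * h i k) ^ 2)]
  refine mul_le_mul_right ?_ _
  calc ∑' i, ∑' j, (∑' k, g j k * h i k) ^ 2
      ≤ ∑' i, ∑' j, (∑' k, g j k ^ 2) * ∑' k, h i k ^ 2 :=
        ENNReal.tsum_le_tsum fun i => ENNReal.tsum_le_tsum fun j => tsum_mul_sq_le _ _
    _ = _ := by
        simp_rw [ENNReal.tsum_mul_right, ENNReal.tsum_mul_left]

lemma tsum_sq_le_of_pairs {ι κ σ : Type*} (A : ι → ℝ≥0∞) (K : ℕ) (P : ℕ → κ → σ → ℝ≥0∞)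
    (α β : ι → σ) (hinj : Function.Injective fun i => (α i, β i)) (N : ℝ≥0∞)
    (hA : ∀ i, A i ≤ ∑ m ∈ Finset.range (K + 1), ∑' x, P m x (α i) * P m x (β i))
    (hP : ∀ m, ∑' x, ∑' s, P m x s ^ 2 ≤ N) :
    ∑' i, A i ^ 2 ≤ ((K + 1) * N) ^ 2 := by
  calc ∑' i, A i ^ 2
      ≤ ∑' i, (K + 1 : ℝ≥0∞) * ∑ m ∈ Finset.range (K + 1),
          (∑' x, P m x (α i) ^ 2) * ∑' x, P m x (β i) ^ 2 := by
        refine ENNReal.tsum_le_tsum fun i => ?_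
        refine (pow_le_pow_left' (hA i) 2).trans ((sum_sq_le _ _).trans ?_)
        rw [Finset.card_range]
        push_cast
        exact mul_le_mul_right (Finset.sum_le_sum fun m _ => tsum_mul_sq_le _ _) _
    _ = (K + 1) * ∑ m ∈ Finset.range (K + 1),
          ∑' i, (∑' x, P m x (α i) ^ 2) * ∑' x, P m x (β i) ^ 2 := by
        rw [ENNReal.tsum_mul_left, Summable.tsum_finsetSum fun _ _ => ENNReal.summable]
    _ ≤ (K + 1) * ∑ m ∈ Finset.range (K + 1), N * N := by
        refine mul_le_mul_right (Finset.sum_le_sum fun m _ => ?_) _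
        have h1 : ∑' s, ∑' x, P m x s ^ 2 ≤ N := by rw [ENNReal.tsum_comm]; exact hP m
        calc _ ≤ ∑' p : σ × σ, (∑' x, P m x p.1 ^ 2) * ∑' x, P m x p.2 ^ 2 :=
              ENNReal.tsum_comp_le_tsum_of_injective hinj _
          _ = (∑' s, ∑' x, P m x s ^ 2) * ∑' s, ∑' x, P m x s ^ 2 := by
              rw [ENNReal.tsum_prod (f := fun s t => (∑' x, P m x s ^ 2) * ∑' x, P m x t ^ 2)]
              simp_rw [ENNReal.tsum_mul_left, ENNReal.tsum_mul_right]
          _ ≤ _ := mul_le_mul' h1 h1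
    _ = _ := by
        rw [Finset.sum_const, Finset.card_range, nsmul_eq_mul]; push_cast; ring

end ENNReal

section Convolution

variable {G : Type*} [Group G]

/-- The squared `ℓ²` norm. -/
noncomputable def nsq {ι : Type*} (f : ι → ℝ≥0∞) : ℝ≥0∞ := ∑' x, f x ^ 2

/-- Convolution of nonnegative functions. -/
noncomputable def cnv (f g : G → ℝ≥0∞) (u : G) : ℝ≥0∞ := ∑' s, f s * g (s⁻¹ * u)

/-- The trilinear form associated with the convolution. -/
noncomputable def tri (f g h : G → ℝ≥0∞) : ℝ≥0∞ := ∑' s, ∑' t, f s * g t * h (s * t)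

lemma tsum_cnv_mul (f g h : G → ℝ≥0∞) : ∑' u, cnv f g u * h u = tri f g h := by
  simp_rw [cnv, tri, ← ENNReal.tsum_mul_right]
  rw [ENNReal.tsum_comm]
  refine tsum_congr fun s => ?_
  rw [← (Equiv.mulLeft s).tsum_eq]
  simp

lemma tri_sq_le (f g h : G → ℝ≥0∞) : tri f g h ^ 2 ≤ nsq (cnv f g) * nsq h := by
  rw [← tsum_cnv_mul]
  exact ENNReal.tsum_mul_sq_le _ _

lemma tri_rotate (f g h : G → ℝ≥0∞) : tri f g h = tri h (fun x => g x⁻¹) f := by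
  calc tri f g h = ∑' t, ∑' s, f s * g t * h (s * t) := ENNReal.tsum_comm
    _ = ∑' t, ∑' u, f (u * t⁻¹) * g t * h u := by
        refine tsum_congr fun t => ?_
        rw [← (Equiv.mulRight t⁻¹).tsum_eq]
        simp
    _ = ∑' v, ∑' u, f (u * v) * g v⁻¹ * h u := by
        rw [← (Equiv.inv G).tsum_eq]
        simp
    _ = _ := by
        rw [ENNReal.tsum_comm, tri]
        exact tsum_congr fun u => tsum_congr fun v => by ring

lemma nsq_inv (f : G → ℝ≥0∞) : nsq (fun x => f x⁻¹) = nsq f :=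
  (Equiv.inv G).tsum_eq (fun x => f x ^ 2)

/-- The squared norm of a convolution as an inner product of two autocorrelations. -/
lemma nsq_cnv_eq (f g : G → ℝ≥0∞) :
    nsq (cnv f g) = ∑' x, (∑' s, f s * f (s * x)) * ∑' t, g (x * t) * g t := by
  have e1 : ∀ u, cnv f g u ^ 2 =
      ∑' s, ∑' x, f s * g (s⁻¹ * u) * (f (s * x) * g (x⁻¹ * s⁻¹ * u)) := by
    intro u
    rw [sq, cnv, ← ENNReal.tsum_mul_right]
    refine tsum_congr fun s => ?_
    rw [← ENNReal.tsum_mul_left, ← (Equiv.mulLeft s).tsum_eq]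
    simp
  calc nsq (cnv f g)
      = ∑' u, ∑' s, ∑' x, f s * g (s⁻¹ * u) * (f (s * x) * g (x⁻¹ * s⁻¹ * u)) :=
        tsum_congr e1
    _ = ∑' s, ∑' x, ∑' u, f s * g (s⁻¹ * u) * (f (s * x) * g (x⁻¹ * s⁻¹ * u)) := by
        rw [ENNReal.tsum_comm]
        exact tsum_congr fun s => ENNReal.tsum_comm
    _ = ∑' s, ∑' x, ∑' t, f s * f (s * x) * (g (x * t) * g t) := by
        refine tsum_congr fun s => tsum_congr fun x => ?_
        rw [← (Equiv.mulLeft (s * x)).tsum_eq]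
        refine tsum_congr fun t => ?_
        simp only [Equiv.coe_mulLeft]
        rw [show s⁻¹ * (s * x * t) = x * t by group, show x⁻¹ * s⁻¹ * (s * x * t) = t by group]
        ring
    _ = _ := by
        rw [ENNReal.tsum_comm]
        refine tsum_congr fun x => ?_
        rw [← ENNReal.tsum_mul_right]
        exact tsum_congr fun s => by rw [ENNReal.tsum_mul_left]

end Convolution

lemma ENNReal.tsum_le_tsum_of_injOn {ι κ : Type*} {φ : ι → ℝ≥0∞} {ψ : κ → ℝ≥0∞} (π : ι → κ)
    (h : ∀ i, φ i ≠ 0 → φ i ≤ ψ (π i))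
    (hinj : ∀ i j, φ i ≠ 0 → φ j ≠ 0 → π i = π j → i = j) : ∑' i, φ i ≤ ∑' k, ψ k := by
  rw [← tsum_subtype_support φ]
  refine (ENNReal.tsum_le_tsum fun i : Function.support φ => h i i.2).trans ?_
  exact ENNReal.tsum_comp_le_tsum_of_injective (f := fun i : Function.support φ => π i)
    (fun i j hij => Subtype.ext (hinj i j i.2 j.2 hij)) ψ

namespace GarsideGroup

open ShiftLattice

open scoped Classical in
/-- The restriction of a function to a set, extended by zero. -/
noncomputable def restrict {ι : Type*} (s : Set ι) (f : ι → ℝ≥0∞) (x : ι) : ℝ≥0∞ :=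
  if x ∈ s then f x else 0

lemma restrict_ne_zero {ι : Type*} {s : Set ι} {f : ι → ℝ≥0∞} {x : ι} (h : restrict s f x ≠ 0) :
    x ∈ s := by
  by_contra hx
  exact h (if_neg hx)

lemma restrict_of_mem {ι : Type*} {s : Set ι} {f : ι → ℝ≥0∞} {x : ι} (h : x ∈ s) :
    restrict s f x = f x := if_pos h

lemma restrict_le {ι : Type*} (s : Set ι) (f : ι → ℝ≥0∞) (x : ι) : restrict s f x ≤ f x := by
  unfold restrict; split_ifs <;> simp

lemma nsq_restrict_le {ι : Type*} (s : Set ι) (f : ι → ℝ≥0∞) : nsq (restrict s f) ≤ nsq f :=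
  ENNReal.tsum_le_tsum fun x => pow_le_pow_left' (restrict_le s f x) 2

variable {G : Type*} [GarsideGroup G]

/-- The values of `f` on products `x * y` of positive elements, with `x` of rank `m`. -/
noncomputable def splitLeft (f : G → ℝ≥0∞) (m : ℕ) (x y : G) : ℝ≥0∞ :=
  restrict {p : G × G | len p.1 = m ∧ 1 ≤ p.1 ∧ 1 ≤ p.2} (fun p => f (p.1 * p.2)) (x, y)

/-- The values of `f` on products `y * x` of positive elements, with `x` of rank `m`. -/
noncomputable def splitRight (f : G → ℝ≥0∞) (m : ℕ) (x y : G) : ℝ≥0∞ :=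
  restrict {p : G × G | len p.1 = m ∧ 1 ≤ p.1 ∧ 1 ≤ p.2} (fun p => f (p.2 * p.1)) (x, y)

lemma le_mul_of_one_le {x y : G} (hy : 1 ≤ y) : x ≤ x * y := by
  have := mul_mono x _ _ hy
  rwa [mul_one] at this

lemma tsum_splitLeft_le {K : ℕ} {f : G → ℝ≥0∞} (hf : ∀ x, f x ≠ 0 → x ∈ chainSet G K) (m : ℕ) :
    ∑' x, ∑' y, splitLeft f m x y ^ 2 ≤ nsq f := by
  rw [← ENNReal.tsum_prod (f := fun x y => splitLeft f m x y ^ 2)]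
  refine ENNReal.tsum_le_tsum_of_injOn (fun p : G × G => p.1 * p.2)
    (fun p _ => pow_le_pow_left' (restrict_le _ _ _) 2) ?_
  rintro ⟨x, y⟩ ⟨x', y'⟩ h h' e
  replace h := (pow_ne_zero_iff two_ne_zero).1 h
  replace h' := (pow_ne_zero_iff two_ne_zero).1 h'
  obtain ⟨h1, h2, h3⟩ := restrict_ne_zero h
  obtain ⟨h1', h2', h3'⟩ := restrict_ne_zero h'
  have hne : f (x * y) ≠ 0 := fun h0 => h (le_antisymm ((restrict_le _ _ _).trans h0.le) bot_le)
  dsimp only at *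
  have hx : x = x' := (hf _ hne).2.1.eq_of_len_eq h2 (le_mul_of_one_le h3) h2'
    (e ▸ le_mul_of_one_le h3') (h1.trans h1'.symm)
  subst hx
  rw [mul_left_cancel e]

lemma tsum_splitRight_le {K : ℕ} {f : G → ℝ≥0∞} (hf : ∀ x, f x ≠ 0 → x ∈ chainSet G K) (m : ℕ) :
    ∑' x, ∑' y, splitRight f m x y ^ 2 ≤ nsq f := by
  rw [← ENNReal.tsum_prod (f := fun x y => splitRight f m x y ^ 2)]
  refine ENNReal.tsum_le_tsum_of_injOn (fun p : G × G => p.2 * p.1)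
    (fun p _ => pow_le_pow_left' (restrict_le _ _ _) 2) ?_
  rintro ⟨x, y⟩ ⟨x', y'⟩ h h' e
  replace h := (pow_ne_zero_iff two_ne_zero).1 h
  replace h' := (pow_ne_zero_iff two_ne_zero).1 h'
  obtain ⟨h1, h2, h3⟩ := restrict_ne_zero h
  obtain ⟨h1', h2', h3'⟩ := restrict_ne_zero h'
  have hne : f (y * x) ≠ 0 := fun h0 => h (le_antisymm ((restrict_le _ _ _).trans h0.le) bot_le)
  dsimp only at *
  have hl := congrArg len e
  rw [len_mul, len_mul] at hl
  have hy : y = y' := (hf _ hne).2.1.eq_of_len_eq h3 (le_mul_of_one_le h2) h3'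
    (e ▸ le_mul_of_one_le h2') (by omega)
  subst hy
  rw [mul_left_cancel e]

lemma tsum_autocorrelation_left_le {K : ℕ} {f : G → ℝ≥0∞}
    (hf : ∀ x, f x ≠ 0 → x ∈ chainSet G K) :
    ∑' x, (∑' s, f s * f (s * x)) ^ 2 ≤ ((K + 1) * nsq f) ^ 2 := by
  refine ENNReal.tsum_sq_le_of_pairs _ K (splitLeft f) (fun g => (1 ⊓ g)⁻¹)
    (fun g => (1 ⊓ g)⁻¹ * g) ?_ _ ?_ (tsum_splitLeft_le hf)
  · intro g g' h
    simp only [Prod.mk.injEq, inv_inj] at h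
    rw [h.1] at h
    exact mul_left_cancel h.2
  · intro g
    rw [← Summable.tsum_finsetSum fun _ _ => ENNReal.summable]
    refine le_trans ?_ ((Equiv.mulRight (1 ⊓ g)).tsum_eq _).le
    refine ENNReal.tsum_le_tsum fun s => ?_
    by_cases h0 : f s * f (s * g) = 0
    · rw [h0]; exact bot_le
    obtain ⟨hs, hsg⟩ := mul_ne_zero_iff.1 h0
    obtain ⟨h1, -, h2⟩ := hf _ hs
    have h3 := (hf _ hsg).1
    have e : s * (1 ⊓ g) = s ⊓ s * g := by rw [mul_inf, mul_one]
    have hx : 1 ≤ s * (1 ⊓ g) := by rw [e]; exact le_inf h1 h3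
    have hl0 := len_mono hx
    have hl1 : len (s * (1 ⊓ g)) ≤ K := by
      refine (len_mono ?_).trans h2
      rw [e]; exact inf_le_left
    rw [len_one] at hl0
    refine le_trans ?_ (Finset.single_le_sum (fun _ _ => bot_le)
      (Finset.mem_range.2 (by omega : (len (s * (1 ⊓ g))).toNat < K + 1)))
    simp only [splitLeft, Equiv.coe_mulRight]
    rw [restrict_of_mem, restrict_of_mem]
    · simp
    · refine ⟨by simp only; omega, hx, ?_⟩
      rw [← mul_le_mul_iff (g := 1 ⊓ g)]
      simp
    · refine ⟨by simp only; omega, hx, ?_⟩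
      rw [← mul_le_mul_iff (g := 1 ⊓ g)]
      simp

lemma tsum_autocorrelation_right_le {K : ℕ} {f : G → ℝ≥0∞}
    (hf : ∀ x, f x ≠ 0 → x ∈ chainSet G K) :
    ∑' x, (∑' t, f (x * t) * f t) ^ 2 ≤ ((K + 1) * nsq f) ^ 2 := by
  refine ENNReal.tsum_sq_le_of_pairs _ K (splitRight f) (fun g => 1 ⊔ g)
    (fun g => g⁻¹ * (1 ⊔ g)) ?_ _ ?_ (tsum_splitRight_le hf)
  · intro g g' h
    simp only [Prod.mk.injEq] at h
    rw [h.1] at h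
    exact inv_injective (mul_right_cancel h.2)
  · intro g
    rw [← Summable.tsum_finsetSum fun _ _ => ENNReal.summable]
    refine le_trans ?_ ((Equiv.mulLeft ((1 ⊔ g)⁻¹ * g)).tsum_eq _).le
    refine ENNReal.tsum_le_tsum fun t => ?_
    by_cases h0 : f (g * t) * f t = 0
    · rw [h0]; exact bot_le
    obtain ⟨hgt, ht⟩ := mul_ne_zero_iff.1 h0
    obtain ⟨h1, -, h2⟩ := hf _ hgt
    have h3 := (hf _ ht).1
    have hx : 1 ≤ (1 ⊔ g)⁻¹ * g * t := by
      rw [← mul_le_mul_iff (g := 1 ⊔ g), mul_one]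
      simpa [mul_assoc] using ⟨h1, le_mul_of_one_le h3⟩
    have hl0 := len_mono hx
    have hl1 : len ((1 ⊔ g)⁻¹ * g * t) ≤ K := by
      have h4 : (0 : ℤ) ≤ len (1 ⊔ g) := by
        rw [← len_one (G := G)]; exact len_mono le_sup_left
      have h5 : len ((1 ⊔ g)⁻¹ * g * t) = len (g * t) - len (1 ⊔ g) := by
        rw [mul_assoc, len_mul, len_inv]; ring
      omega
    rw [len_one] at hl0
    refine le_trans ?_ (Finset.single_le_sum (fun _ _ => bot_le)
      (Finset.mem_range.2 (by omega : (len ((1 ⊔ g)⁻¹ * g * t)).toNat < K + 1)))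
    simp only [splitRight, Equiv.coe_mulLeft]
    rw [restrict_of_mem, restrict_of_mem]
    · simp [mul_assoc]
    · refine ⟨by simp only; omega, hx, ?_⟩
      rw [← mul_le_mul_iff (g := g)]
      simp
    · exact ⟨by simp only; omega, hx, le_sup_left⟩

theorem nsq_cnv_le_of_chainSet {K : ℕ} {f g : G → ℝ≥0∞} (hf : ∀ x, f x ≠ 0 → x ∈ chainSet G K)
    (hg : ∀ x, g x ≠ 0 → x ∈ chainSet G K) :
    nsq (cnv f g) ≤ (K + 1) ^ 2 * (nsq f * nsq g) := by
  apply ENNReal.le_of_sq_le_sq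
  rw [nsq_cnv_eq]
  refine (ENNReal.tsum_mul_sq_le _ _).trans ((mul_le_mul' (tsum_autocorrelation_left_le hf)
    (tsum_autocorrelation_right_le hg)).trans_eq ?_)
  ring

lemma tri_sq_le_of_chainSet {K : ℕ} {f g h : G → ℝ≥0∞} (hf : ∀ x, f x ≠ 0 → x ∈ chainSet G K)
    (hg : ∀ x, g x ≠ 0 → x ∈ chainSet G K) :
    tri f g h ^ 2 ≤ (K + 1) ^ 2 * (nsq f * nsq g * nsq h) := by
  refine (tri_sq_le f g h).trans ((mul_le_mul_left (nsq_cnv_le_of_chainSet hf hg) _).trans_eq ?_)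
  ring

/-- The pairs of hull points of the side from `1` to `s`, seen from both ends. -/
def hullPairs (M : ℤ) (s : G) : Set (G × G) := {p | Hull M 1 s p.1 ∧ Hull M 1 s (s * p.2)}

/-- The values of `f` at `p * x * q⁻¹` when `p` and `q` are hull points of that element. -/
noncomputable def spread (M : ℤ) (f : G → ℝ≥0∞) (x : G) (p q : G) : ℝ≥0∞ :=
  restrict {x | (p, q) ∈ hullPairs M x} f (p * x * q⁻¹)

/-- The function obtained by moving the values of `f` along all pairs of hull points. -/
noncomputable def reduced (M : ℤ) (f : G → ℝ≥0∞) (x : G) : ℝ≥0∞ :=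
  (∑' p, ∑' q, spread M f x p q ^ 2) ^ (1 / 2 : ℝ)

lemma reduced_sq (M : ℤ) (f : G → ℝ≥0∞) (x : G) :
    reduced M f x ^ 2 = ∑' p, ∑' q, spread M f x p q ^ 2 := by
  rw [reduced, ← ENNReal.rpow_natCast, ← ENNReal.rpow_mul]
  norm_num

lemma tsum_hull_le (M : ℕ) (s : G) (g : G) :
    ∑' p, restrict {p | Hull M 1 s (g * p)} (fun _ => 1) p ≤ (2 * (2 * M + 1) ^ 5 : ℕ) := by
  have e : ∑' p, restrict {p | Hull M 1 s (g * p)} (fun _ => 1) p =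
      ∑' p, restrict {p | Hull M 1 s p} (fun _ => (1 : ℝ≥0∞)) p :=
    (Equiv.mulLeft g).tsum_eq (fun p => restrict {p | Hull M 1 s p} (fun _ => (1 : ℝ≥0∞)) p)
  have e2 : ∀ p, restrict {p | Hull M 1 s p} (fun _ => (1 : ℝ≥0∞)) p =
      Set.indicator {p | Hull M 1 s p} 1 p := fun p => by
    classical
    simp [restrict, Set.indicator_apply]
  rw [e]
  simp_rw [e2]
  rw [← tsum_subtype]
  have := ENNReal.tsum_set_one {p | Hull M 1 s p}
  simp only [Pi.one_apply]
  rw [this]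
  have h := encard_hull_le M 1 s
  calc _ ≤ (((2 * (2 * M + 1) ^ 5 : ℕ) : ℕ∞) : ℝ≥0∞) := by exact_mod_cast h
    _ = _ := by simp

lemma nsq_reduced_le (M : ℕ) (f : G → ℝ≥0∞) :
    nsq (reduced M f) ≤ ((2 * (2 * M + 1) ^ 5 : ℕ) : ℝ≥0∞) ^ 2 * nsq f := by
  set N := ((2 * (2 * M + 1) ^ 5 : ℕ) : ℝ≥0∞) with hN
  calc nsq (reduced M f) = ∑' x, ∑' p, ∑' q, spread M f x p q ^ 2 :=
        tsum_congr fun x => reduced_sq _ _ _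
    _ = ∑' p, ∑' q, ∑' x, spread M f x p q ^ 2 := by
        rw [ENNReal.tsum_comm]
        exact tsum_congr fun p => ENNReal.tsum_comm
    _ = ∑' p, ∑' q, ∑' s, restrict {x | (p, q) ∈ hullPairs M x} f s ^ 2 :=
        tsum_congr fun p => tsum_congr fun q =>
          ((Equiv.mulLeft p).trans (Equiv.mulRight q⁻¹)).tsum_eq
            (fun s => restrict {x | (p, q) ∈ hullPairs M x} f s ^ 2)
    _ = ∑' s, ∑' p, ∑' q, restrict {x | (p, q) ∈ hullPairs M x} f s ^ 2 :=
        (tsum_congr fun p => ENNReal.tsum_comm).trans ENNReal.tsum_comm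
    _ ≤ ∑' s, ∑' p, ∑' q, f s ^ 2 * (restrict {p | Hull M 1 s (1 * p)} (fun _ => 1) p *
          restrict {q | Hull M 1 s (s * q)} (fun _ => 1) q) := by
        refine ENNReal.tsum_le_tsum fun s => ENNReal.tsum_le_tsum fun p =>
          ENNReal.tsum_le_tsum fun q => ?_
        by_cases h : (p, q) ∈ hullPairs M s
        · rw [restrict_of_mem (show s ∈ {x | (p, q) ∈ hullPairs M x} from h), restrict_of_mem,
            restrict_of_mem]
          · simp
          · exact h.2
          · simpa using h.1
        · rw [restrict, if_neg (show s ∉ {x | (p, q) ∈ hullPairs M x} from h)]; simp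
    _ ≤ ∑' s, f s ^ 2 * (N * N) := by
        refine ENNReal.tsum_le_tsum fun s => ?_
        simp_rw [ENNReal.tsum_mul_left, ENNReal.tsum_mul_right]
        exact mul_le_mul_right (mul_le_mul' (tsum_hull_le M s 1) (tsum_hull_le M s s)) _
    _ = _ := by rw [ENNReal.tsum_mul_right, nsq]; ring

/-- The pairs whose product is reduced to elements with chain intervals. -/
def reducedPairs (G : Type*) [GarsideGroup G] (K : ℕ) : Set (G × G) :=
  {p | p.1 ∈ chainSet G K ∧ p.2 ∈ chainSet G K}

/-- The pairs whose product is reduced after rotating the triangle. -/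
def rotatedPairs (G : Type*) [GarsideGroup G] (K : ℕ) : Set (G × G) :=
  {p | p.1 * p.2 ∈ chainSet G K ∧ p.2⁻¹ ∈ chainSet G K}

lemma tri_le_reduced (n : ℕ) {f g h : G → ℝ≥0∞} (hf : ∀ x, f x ≠ 0 → Near n 1 x)
    (hg : ∀ x, g x ≠ 0 → Near n 1 x) (hh : ∀ x, h x ≠ 0 → Near n 1 x) (M : ℤ)
    (hM : M = 6860 * n) (K : ℕ) (hK : K = 68600 * n) :
    tri f g h ≤ ∑' s, ∑' t, restrict (reducedPairs G K ∪ rotatedPairs G K) (fun _ => 1) (s, t) *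
      (reduced M f s * reduced M g t * reduced M h (s * t)) := by
  set W : G → G → ℝ≥0∞ := fun s t =>
    restrict (reducedPairs G K ∪ rotatedPairs G K) (fun _ => 1) (s, t) with hW
  set Z : G × G × G → G → G → ℝ≥0∞ := fun π s t => W s t *
    (spread M f s π.1 π.2.1 * spread M g t π.2.1 π.2.2 * spread M h (s * t) π.1 π.2.2) with hZ
  calc tri f g h
      ≤ ∑' s, ∑' t, ∑' π : G × G × G, Z π (π.1⁻¹ * s * π.2.1) (π.2.1⁻¹ * t * π.2.2) := by
        refine ENNReal.tsum_le_tsum fun s => ENNReal.tsum_le_tsum fun t => ?_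
        by_cases h0 : f s * g t * h (s * t) = 0
        · rw [h0]; exact bot_le
        obtain ⟨h1, h3⟩ := mul_ne_zero_iff.1 h0
        obtain ⟨h1, h2⟩ := mul_ne_zero_iff.1 h1
        obtain ⟨p, q, r, k1, k2, k3, k4, k5, k6, k7⟩ :=
          exists_reduction n s t (hf _ h1) (hg _ h2) (hh _ h3)
        refine le_trans (le_of_eq ?_) (ENNReal.le_tsum (p, q, r))
        rw [← hM] at k1 k2 k3 k4 k5 k6
        rw [← hK] at k7
        have e : p⁻¹ * s * q * (q⁻¹ * t * r) = p⁻¹ * (s * t) * r := by group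
        have w1 : W (p⁻¹ * s * q) (q⁻¹ * t * r) = 1 := restrict_of_mem <| by
          rcases k7 with k7 | k7
          · exact Or.inl k7
          · exact Or.inr (by simpa only [rotatedPairs, Set.mem_ofPred_eq, e] using k7)
        have key : ∀ (φ : G → ℝ≥0∞) (u v w : G), Hull M 1 u v → Hull M 1 u (u * w) →
            spread M φ (v⁻¹ * u * w) v w = φ u := by
          intro φ u v w h1 h2
          have : v * (v⁻¹ * u * w) * w⁻¹ = u := by group
          rw [spread, this]
          exact restrict_of_mem ⟨h1, h2⟩
        simp only [hZ]
        rw [w1, e, key f _ _ _ k1 k2, key g _ _ _ k3 k4, key h _ _ _ k5 k6, one_mul]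
    _ = ∑' π : G × G × G, ∑' s, ∑' t, Z π (π.1⁻¹ * s * π.2.1) (π.2.1⁻¹ * t * π.2.2) := by
        rw [ENNReal.tsum_comm (α := G × G × G)]
        exact tsum_congr fun p => ENNReal.tsum_comm
    _ = ∑' π : G × G × G, ∑' s, ∑' t, Z π s t := by
        refine tsum_congr fun π => ?_
        refine Eq.trans ?_ (((Equiv.mulLeft π.1⁻¹).trans (Equiv.mulRight π.2.1)).tsum_eq _)
        refine tsum_congr fun s => ?_
        exact ((Equiv.mulLeft π.2.1⁻¹).trans (Equiv.mulRight π.2.2)).tsum_eq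
          (fun t => Z π (π.1⁻¹ * s * π.2.1) t)
    _ = ∑' s, ∑' t, ∑' π : G × G × G, Z π s t := by
        rw [ENNReal.tsum_comm]
        exact tsum_congr fun p => ENNReal.tsum_comm
    _ ≤ _ := by
        refine ENNReal.tsum_le_tsum fun s => ENNReal.tsum_le_tsum fun t => ?_
        simp only [hZ]
        rw [ENNReal.tsum_mul_left]
        refine mul_le_mul_right (ENNReal.le_of_sq_le_sq ?_) _
        rw [mul_pow, mul_pow, reduced_sq, reduced_sq, reduced_sq,
          ENNReal.tsum_prod (f := fun p (π : G × G) => spread M f s p π.1 * spread M g t π.1 π.2 *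
            spread M h (s * t) p π.2)]
        have : ∀ p, ∑' π : G × G, spread M f s p π.1 * spread M g t π.1 π.2 *
            spread M h (s * t) p π.2 = ∑' q, ∑' r, spread M f s p q * spread M g t q r *
            spread M h (s * t) p r := fun p =>
          ENNReal.tsum_prod (f := fun q r => spread M f s p q * spread M g t q r *
            spread M h (s * t) p r)
        simp_rw [this]
        exact ENNReal.tsum_triangle_sq_le _ _ _

theorem tri_sq_le_of_near (n : ℕ) {f g h : G → ℝ≥0∞} (hf : ∀ x, f x ≠ 0 → Near n 1 x)
    (hg : ∀ x, g x ≠ 0 → Near n 1 x) (hh : ∀ x, h x ≠ 0 → Near n 1 x) :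
    tri f g h ^ 2 ≤ 4 * (68600 * n + 1) ^ 2 *
      ((2 * (2 * (6860 * n : ℕ) + 1) ^ 5 : ℕ) : ℝ≥0∞) ^ 6 * (nsq f * nsq g * nsq h) := by
  set K := 68600 * n with hK
  set M : ℕ := 6860 * n with hM
  set N := ((2 * (2 * M + 1) ^ 5 : ℕ) : ℝ≥0∞) with hN
  set F := reduced M f with hF
  set D := reduced M g with hD
  set H := reduced M h with hH
  set C := chainSet G K with hC
  have h1 : tri f g h ≤ tri (restrict C F) (restrict C D) H +
      tri (restrict C H) (fun x => restrict {x | x⁻¹ ∈ C} D x⁻¹) F := by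
    refine (tri_le_reduced n hf hg hh M (by rw [hM]; push_cast; ring) K hK).trans ?_
    rw [← tri_rotate, tri, tri, ← ENNReal.tsum_add]
    refine ENNReal.tsum_le_tsum fun s => ?_
    rw [← ENNReal.tsum_add]
    refine ENNReal.tsum_le_tsum fun t => ?_
    by_cases hst : (s, t) ∈ reducedPairs G K ∪ rotatedPairs G K
    · rw [restrict_of_mem hst, one_mul]
      rcases hst with hst | hst
      · refine le_trans (le_of_eq ?_) le_self_add
        rw [restrict_of_mem hst.1, restrict_of_mem hst.2]
      · refine le_trans (le_of_eq ?_) le_add_self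
        rw [restrict_of_mem (show s * t ∈ C from hst.1),
          restrict_of_mem (show t ∈ {x : G | x⁻¹ ∈ C} from hst.2)]
    · rw [restrict, if_neg hst, zero_mul]; exact bot_le
  have h2 : tri (restrict C F) (restrict C D) H ^ 2 ≤ (K + 1) ^ 2 * (nsq F * nsq D * nsq H) := by
    refine (tri_sq_le_of_chainSet (K := K) (fun x => restrict_ne_zero)
      (fun x => restrict_ne_zero)).trans ?_
    gcongr <;> exact nsq_restrict_le _ _
  have h3 : tri (restrict C H) (fun x => restrict {x | x⁻¹ ∈ C} D x⁻¹) F ^ 2 ≤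
      (K + 1) ^ 2 * (nsq F * nsq D * nsq H) := by
    refine (tri_sq_le_of_chainSet (K := K) (fun x => restrict_ne_zero)
      (fun x hx => by simpa using restrict_ne_zero hx)).trans ?_
    rw [nsq_inv (restrict {x | x⁻¹ ∈ C} D),
      show nsq F * nsq D * nsq H = nsq H * nsq D * nsq F by ring]
    gcongr <;> exact nsq_restrict_le _ _
  have h4 : nsq F * nsq D * nsq H ≤ N ^ 6 * (nsq f * nsq g * nsq h) := by
    calc _ ≤ (N ^ 2 * nsq f) * (N ^ 2 * nsq g) * (N ^ 2 * nsq h) := by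
          gcongr <;> exact nsq_reduced_le _ _
      _ = _ := by ring
  have h5 : ∀ x y : ℝ≥0∞, (x + y) ^ 2 ≤ 2 * (x ^ 2 + y ^ 2) := fun x y => by
    calc (x + y) ^ 2 = x ^ 2 + y ^ 2 + 2 * (x * y) := by ring
      _ ≤ x ^ 2 + y ^ 2 + (x ^ 2 + y ^ 2) := by
        gcongr; exact ENNReal.two_mul_mul_le_sq_add_sq x y
      _ = _ := by ring
  calc tri f g h ^ 2 ≤ (tri (restrict C F) (restrict C D) H +
      tri (restrict C H) (fun x => restrict {x | x⁻¹ ∈ C} D x⁻¹) F) ^ 2 := pow_le_pow_left' h1 2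
    _ ≤ 2 * ((K + 1) ^ 2 * (nsq F * nsq D * nsq H) + (K + 1) ^ 2 * (nsq F * nsq D * nsq H)) :=
        (h5 _ _).trans (mul_le_mul_right (add_le_add h2 h3) _)
    _ ≤ 2 * ((K + 1) ^ 2 * (N ^ 6 * (nsq f * nsq g * nsq h)) +
          (K + 1) ^ 2 * (N ^ 6 * (nsq f * nsq g * nsq h))) := by gcongr
    _ = _ := by rw [hK]; push_cast; ring

end GarsideGroup

namespace ENNReal

lemma le_of_forall_pow_two_pow_le {x y K : ℝ≥0∞} (hK : K ≠ ⊤)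
    (h : ∀ m : ℕ, x ^ 2 ^ m ≤ y ^ 2 ^ m * K) : x ≤ y := by
  by_contra! hxy
  have hy : y ≠ ⊤ := (hxy.trans_le le_top).ne
  have hy0 : y ≠ 0 := by
    rintro rfl
    have := h 0
    simp only [pow_zero, pow_one, zero_mul] at this
    exact absurd hxy (not_lt.2 this)
  have h1 : 1 < x / y := by
    rw [ENNReal.lt_div_iff_mul_lt (Or.inl hy0) (Or.inl hy), one_mul]
    exact hxy
  have h2 : ∀ m : ℕ, (x / y) ^ m ≤ K := fun m => by
    have h3 : (x / y) ^ 2 ^ m ≤ K := by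
      rw [div_eq_mul_inv, mul_pow, ← ENNReal.inv_pow, ← div_eq_mul_inv]
      exact ENNReal.div_le_of_le_mul' (h m)
    exact (pow_le_pow_right₀ h1.le Nat.lt_two_pow_self.le).trans h3
  have h4 := (ENNReal.tendsto_pow_atTop_nhds_top_iff).2 h1
  exact hK (top_le_iff.1 (le_of_tendsto' h4 h2))

end ENNReal

section Convolution

variable {G : Type*} [Group G]

lemma tsum_cnv (f g : G → ℝ≥0∞) : ∑' u, cnv f g u = (∑' s, f s) * ∑' t, g t := by
  have := tsum_cnv_mul f g (fun _ => 1)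
  simp only [mul_one] at this
  rw [this, tri]
  simp_rw [mul_one, ENNReal.tsum_mul_left, ENNReal.tsum_mul_right]

lemma nsq_cnv_le_tsum (f g : G → ℝ≥0∞) : nsq (cnv f g) ≤ nsq f * (∑' t, g t) ^ 2 := by
  have h : ∀ u, cnv f g u ^ 2 ≤ (∑' s, f s ^ 2 * g (s⁻¹ * u)) * ∑' t, g t := fun u => by
    have e : ∀ s, f s * g (s⁻¹ * u) =
        (f s * g (s⁻¹ * u) ^ (1 / 2 : ℝ)) * g (s⁻¹ * u) ^ (1 / 2 : ℝ) := fun s => by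
      rw [mul_assoc, ← ENNReal.rpow_add_of_nonneg _ _ (by norm_num) (by norm_num)]
      norm_num
    have e2 : ∀ s, (g (s⁻¹ * u) ^ (1 / 2 : ℝ)) ^ 2 = g (s⁻¹ * u) := fun s => by
      rw [← ENNReal.rpow_natCast, ← ENNReal.rpow_mul]
      norm_num
    rw [cnv]
    simp_rw [e]
    refine (ENNReal.tsum_mul_sq_le _ _).trans (le_of_eq ?_)
    simp_rw [mul_pow, e2]
    congr 1
    exact ((Equiv.inv G).trans (Equiv.mulRight u)).tsum_eq g
  calc nsq (cnv f g) ≤ ∑' u, (∑' s, f s ^ 2 * g (s⁻¹ * u)) * ∑' t, g t :=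
        ENNReal.tsum_le_tsum h
    _ = (∑' u, cnv (fun s => f s ^ 2) g u) * ∑' t, g t := ENNReal.tsum_mul_right
    _ = _ := by rw [tsum_cnv, nsq]; ring

lemma cnv_assoc (f g h : G → ℝ≥0∞) : cnv (cnv f g) h = cnv f (cnv g h) := by
  ext u
  have := tsum_cnv_mul f g (fun s => h (s⁻¹ * u))
  rw [cnv, this, tri, cnv]
  refine tsum_congr fun s => ?_
  rw [cnv, ← ENNReal.tsum_mul_left]
  refine tsum_congr fun t => ?_
  rw [mul_assoc, mul_inv_rev, mul_assoc]

lemma cnv_symm {f : G → ℝ≥0∞} (hf : ∀ s, f s⁻¹ = f s) (u : G) : cnv f f u⁻¹ = cnv f f u := by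
  refine Eq.trans ?_ ((Equiv.mulLeft u).tsum_eq (fun s => f s * f (s⁻¹ * u)))
  refine tsum_congr fun s => ?_
  have e1 : (Equiv.mulLeft u s)⁻¹ * u = s⁻¹ := by simp
  have e2 : s⁻¹ * u⁻¹ = (Equiv.mulLeft u s)⁻¹ := by simp
  rw [e1, e2, hf, hf, mul_comm]

lemma nsq_cnv_sq_le {f : G → ℝ≥0∞} (hf : ∀ s, f s⁻¹ = f s) (ξ : G → ℝ≥0∞) :
    nsq (cnv f ξ) ^ 2 ≤ nsq ξ * nsq (cnv (cnv f f) ξ) := by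
  have h : nsq (cnv f ξ) = ∑' t, ξ t * cnv (cnv f f) ξ t := by
    calc nsq (cnv f ξ) = ∑' u, cnv f ξ u * cnv f ξ u := tsum_congr fun u => sq _
      _ = ∑' t, ∑' s, f s * ξ t * cnv f ξ (s * t) := by
        rw [tsum_cnv_mul, tri, ENNReal.tsum_comm]
      _ = _ := by
        refine tsum_congr fun t => ?_
        rw [cnv_assoc, cnv, ← ENNReal.tsum_mul_left, ← (Equiv.inv G).tsum_eq]
        refine tsum_congr fun s => ?_
        simp only [Equiv.inv_apply, hf]
        ring
  rw [h]
  exact ENNReal.tsum_mul_sq_le _ _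

/-- Iterated convolution squares of a function. -/
noncomputable def cnvPow (f : G → ℝ≥0∞) : ℕ → G → ℝ≥0∞
  | 0 => f
  | m + 1 => cnv (cnvPow f m) (cnvPow f m)

lemma cnvPow_symm {f : G → ℝ≥0∞} (hf : ∀ s, f s⁻¹ = f s) (m : ℕ) :
    ∀ s, cnvPow f m s⁻¹ = cnvPow f m s := by
  induction m with
  | zero => exact hf
  | succ m ih => exact cnv_symm ih

lemma tsum_cnvPow_ne_top {f : G → ℝ≥0∞} (hf : ∑' s, f s ≠ ⊤) (m : ℕ) :
    ∑' s, cnvPow f m s ≠ ⊤ := by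
  induction m with
  | zero => exact hf
  | succ m ih => rw [cnvPow, tsum_cnv]; exact ENNReal.mul_ne_top ih ih

lemma nsq_cnvPow_ne_top {f : G → ℝ≥0∞} (hf : ∑' s, f s ≠ ⊤) (hf' : nsq f ≠ ⊤) (m : ℕ) :
    nsq (cnvPow f m) ≠ ⊤ := by
  induction m with
  | zero => exact hf'
  | succ m ih =>
    refine ne_top_of_le_ne_top ?_ (nsq_cnv_le_tsum _ _)
    exact ENNReal.mul_ne_top ih (ENNReal.pow_ne_top (tsum_cnvPow_ne_top hf m))

lemma nsq_cnv_pow_le {f : G → ℝ≥0∞} (hf : ∀ s, f s⁻¹ = f s) {ξ : G → ℝ≥0∞} (h1 : nsq ξ ≠ ⊤)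
    (m : ℕ) : nsq (cnv f ξ) ^ 2 ^ m * nsq ξ ≤ nsq ξ ^ 2 ^ m * nsq (cnv (cnvPow f m) ξ) := by
  induction m with
  | zero => simp [cnvPow, mul_comm]
  | succ m ih =>
    rcases eq_or_ne (nsq ξ) 0 with h0 | h0
    · simp [h0]
    have h2 : (nsq (cnv f ξ) ^ 2 ^ (m + 1) * nsq ξ) * nsq ξ ≤
        (nsq ξ ^ 2 ^ (m + 1) * nsq (cnv (cnvPow f (m + 1)) ξ)) * nsq ξ := by
      calc _ = (nsq (cnv f ξ) ^ 2 ^ m * nsq ξ) ^ 2 := by ring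
        _ ≤ (nsq ξ ^ 2 ^ m * nsq (cnv (cnvPow f m) ξ)) ^ 2 := pow_le_pow_left' ih 2
        _ = nsq ξ ^ 2 ^ (m + 1) * nsq (cnv (cnvPow f m) ξ) ^ 2 := by ring
        _ ≤ nsq ξ ^ 2 ^ (m + 1) * (nsq ξ * nsq (cnv (cnvPow f (m + 1)) ξ)) := by
          gcongr
          exact nsq_cnv_sq_le (cnvPow_symm hf m) ξ
        _ = _ := by ring
    exact (ENNReal.mul_le_mul_iff_left h0 h1).1 h2

end Convolution

namespace GarsideGroup

open ShiftLattice

variable {G : Type*} [GarsideGroup G]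

/-- The polynomial bounding the convolution norm on the ball of radius `n`. -/
def decayBound (n : ℕ) : ℕ := 4 * (68600 * n + 1) ^ 2 * (2 * (2 * (6860 * n) + 1) ^ 5) ^ 6

lemma one_le_decayBound (n : ℕ) : 1 ≤ decayBound n := by
  unfold decayBound
  exact Nat.pos_of_ne_zero (by positivity)

lemma decayBound_two_mul_le (n : ℕ) : decayBound (2 * n) ≤ 2 ^ 32 * decayBound n := by
  calc decayBound (2 * n) ≤ 4 * (2 * (68600 * n + 1)) ^ 2 *
        (2 * (2 * (2 * (6860 * n) + 1)) ^ 5) ^ 6 := by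
        unfold decayBound
        gcongr <;> omega
    _ = _ := by unfold decayBound; ring

lemma decayBound_pow_le (n m : ℕ) : decayBound (2 ^ m * n) ≤ (2 ^ 32) ^ m * decayBound n := by
  induction m with
  | zero => simp
  | succ m ih =>
    calc decayBound (2 ^ (m + 1) * n) = decayBound (2 * (2 ^ m * n)) := by ring_nf
      _ ≤ 2 ^ 32 * decayBound (2 ^ m * n) := decayBound_two_mul_le _
      _ ≤ 2 ^ 32 * ((2 ^ 32) ^ m * decayBound n) := by gcongr
      _ = _ := by ring

lemma near_mul {m n : ℤ} {x y : G} (hx : Near m 1 x) (hy : Near n 1 y) :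
    Near (m + n) 1 (x * y) := by
  refine hx.trans ?_
  have := (near_mul_iff (g := x)).2 hy
  rwa [mul_one] at this

lemma near_inv {n : ℤ} {x : G} (hx : Near n 1 x) : Near n 1 x⁻¹ := by
  have := (near_mul_iff (g := x⁻¹)).2 hx
  rw [mul_one, inv_mul_cancel] at this
  exact this.symm

lemma near_of_cnv_ne_zero {n : ℤ} {f g : G → ℝ≥0∞} (hf : ∀ x, f x ≠ 0 → Near n 1 x)
    (hg : ∀ x, g x ≠ 0 → Near n 1 x) (x : G) (hx : cnv f g x ≠ 0) : Near (n + n) 1 x := by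
  obtain ⟨s, hs⟩ := not_forall.1 (mt ENNReal.tsum_eq_zero.2 hx)
  have := near_mul (hf s (left_ne_zero_of_mul hs)) (hg _ (right_ne_zero_of_mul hs))
  rwa [mul_inv_cancel_left] at this

lemma nsq_cnv_le_of_near (n : ℕ) {f g : G → ℝ≥0∞} (hf : ∀ x, f x ≠ 0 → Near n 1 x)
    (hg : ∀ x, g x ≠ 0 → Near n 1 x) (hfin : nsq (cnv f g) ≠ ⊤) :
    nsq (cnv f g) ≤ decayBound (2 * n) * (nsq f * nsq g) := by
  rcases eq_or_ne (nsq (cnv f g)) 0 with h0 | h0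
  · rw [h0]; exact bot_le
  have hpos : ∀ x : G, Near n 1 x → Near ((2 * n : ℕ) : ℤ) 1 x := fun x hx => by
    have := hx.bounds
    exact hx.mono (by push_cast; omega)
  have h1 := tri_sq_le_of_near (2 * n) (fun x hx => hpos x (hf x hx))
    (fun x hx => hpos x (hg x hx))
    (fun x hx => (near_of_cnv_ne_zero hf hg x hx).mono (by push_cast; omega))
  rw [← tsum_cnv_mul] at h1
  have e : ∑' u, cnv f g u * cnv f g u = nsq (cnv f g) := tsum_congr fun u => (sq _).symm
  rw [e] at h1
  refine (ENNReal.mul_le_mul_iff_left h0 hfin).1 ?_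
  rw [← sq]
  refine h1.trans (le_of_eq ?_)
  unfold decayBound
  push_cast
  ring

lemma near_of_cnvPow_ne_zero {n : ℕ} {f : G → ℝ≥0∞} (hf : ∀ x, f x ≠ 0 → Near n 1 x) (m : ℕ) :
    ∀ x, cnvPow f m x ≠ 0 → Near ((2 ^ m * n : ℕ) : ℤ) 1 x := by
  induction m with
  | zero => simpa [cnvPow] using hf
  | succ m ih =>
    intro x hx
    exact (near_of_cnv_ne_zero ih ih x hx).mono (by push_cast; ring_nf; rfl)

lemma nsq_cnvPow_le {n : ℕ} {f : G → ℝ≥0∞} (hf : ∀ x, f x ≠ 0 → Near n 1 x)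
    (h1 : ∑' s, f s ≠ ⊤) (h2 : nsq f ≠ ⊤) (m : ℕ) :
    nsq (cnvPow f m) * (decayBound (2 * n) * (2 ^ 32) ^ (m + 1)) ≤
      (decayBound (2 * n) * 2 ^ 32 * nsq f) ^ 2 ^ m := by
  induction m with
  | zero => simp only [cnvPow]; exact le_of_eq (by ring)
  | succ m ih =>
    have h3 : nsq (cnvPow f (m + 1)) ≤
        ((2 ^ 32) ^ m * decayBound (2 * n)) * (nsq (cnvPow f m) * nsq (cnvPow f m)) := by
      refine (nsq_cnv_le_of_near (2 ^ m * n) (near_of_cnvPow_ne_zero hf m)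
        (near_of_cnvPow_ne_zero hf m) (nsq_cnvPow_ne_top h1 h2 (m + 1))).trans ?_
      gcongr
      have := decayBound_pow_le (2 * n) m
      rw [show 2 * (2 ^ m * n) = 2 ^ m * (2 * n) by ring]
      exact_mod_cast this
    calc _ ≤ ((2 ^ 32) ^ m * decayBound (2 * n)) * (nsq (cnvPow f m) * nsq (cnvPow f m)) *
          (decayBound (2 * n) * (2 ^ 32) ^ (m + 1 + 1)) := by gcongr
      _ = (nsq (cnvPow f m) * (decayBound (2 * n) * (2 ^ 32) ^ (m + 1))) ^ 2 := by ring
      _ ≤ ((decayBound (2 * n) * 2 ^ 32 * nsq f) ^ 2 ^ m) ^ 2 := pow_le_pow_left' ih 2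
      _ = _ := by ring

lemma nsq_cnv_le_of_tsum_ne_top {n : ℕ} {f : G → ℝ≥0∞} (hf : ∀ x, f x ≠ 0 → Near n 1 x)
    (hsymm : ∀ s, f s⁻¹ = f s) (h1 : ∑' s, f s ≠ ⊤) (h2 : nsq f ≠ ⊤) {ξ : G → ℝ≥0∞}
    (h3 : ∑' s, ξ s ≠ ⊤) (h4 : nsq ξ ≠ ⊤) :
    nsq (cnv f ξ) ≤ decayBound (2 * n) * 2 ^ 32 * nsq f * nsq ξ := by
  rcases eq_or_ne (nsq ξ) 0 with h0 | h0
  · have h5 := nsq_cnv_sq_le hsymm ξ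
    rw [h0, zero_mul, nonpos_iff_eq_zero, pow_eq_zero_iff two_ne_zero] at h5
    rw [h5]; exact bot_le
  refine ENNReal.le_of_forall_pow_two_pow_le (K := (∑' s, ξ s) ^ 2 / nsq ξ)
    (ENNReal.div_ne_top (ENNReal.pow_ne_top h3) h0) fun m => ?_
  rw [← mul_div_assoc, ENNReal.le_div_iff_mul_le (Or.inl h0) (Or.inl h4)]
  refine (nsq_cnv_pow_le hsymm h4 m).trans ?_
  calc _ ≤ nsq ξ ^ 2 ^ m * (nsq (cnvPow f m) * (∑' s, ξ s) ^ 2) := by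
        gcongr
        exact nsq_cnv_le_tsum _ _
    _ ≤ nsq ξ ^ 2 ^ m * ((decayBound (2 * n) * 2 ^ 32 * nsq f) ^ 2 ^ m * (∑' s, ξ s) ^ 2) := by
        gcongr
        refine le_trans ?_ (nsq_cnvPow_le hf h1 h2 m)
        refine le_mul_of_one_le_right' ?_
        have := one_le_decayBound (2 * n)
        exact one_le_mul (by exact_mod_cast this) (one_le_pow₀ (by norm_num))
    _ = _ := by rw [mul_pow _ (nsq ξ)]; ring

/-- Rapid decay for left convolution by a symmetric function supported near the identity. -/
theorem nsq_cnv_le {n : ℕ} {f : G → ℝ≥0∞} (hf : ∀ x, f x ≠ 0 → Near n 1 x)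
    (hsymm : ∀ s, f s⁻¹ = f s) (hfin : (Function.support f).Finite) (htop : ∀ s, f s ≠ ⊤)
    {ξ : G → ℝ≥0∞} (hξ : ∀ s, ξ s ≠ ⊤) :
    nsq (cnv f ξ) ≤ decayBound (2 * n) * 2 ^ 32 * nsq f * nsq ξ := by
  classical
  have key : ∀ (φ : G → ℝ≥0∞) (T : Finset G), (∀ s, s ∉ T → φ s = 0) → (∀ s, φ s ≠ ⊤) →
      ∑' s, φ s ≠ ⊤ ∧ nsq φ ≠ ⊤ := by
    intro φ T h1 h2
    rw [nsq, tsum_eq_sum fun s hs => h1 s hs, tsum_eq_sum (s := T) fun s hs => by simp [h1 s hs]]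
    exact ⟨ENNReal.sum_ne_top.2 fun s _ => h2 s,
      ENNReal.sum_ne_top.2 fun s _ => ENNReal.pow_ne_top (h2 s)⟩
  obtain ⟨f1, f2⟩ := key f hfin.toFinset (fun s hs => by simpa using hs) htop
  rw [nsq, ENNReal.tsum_eq_iSup_sum]
  refine iSup_le fun O => ?_
  set T : Finset G := Finset.image₂ (fun s u => s⁻¹ * u) hfin.toFinset O with hT
  set η : G → ℝ≥0∞ := fun s => if s ∈ T then ξ s else 0 with hη
  obtain ⟨e1, e2⟩ := key η T (fun s hs => if_neg hs) (fun s => by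
    simp only [hη]; split_ifs; exacts [hξ s, ENNReal.zero_ne_top])
  calc ∑ u ∈ O, cnv f ξ u ^ 2 = ∑ u ∈ O, cnv f η u ^ 2 := by
        refine Finset.sum_congr rfl fun u hu => ?_
        congr 1
        refine tsum_congr fun s => ?_
        by_cases hs : f s = 0
        · simp [hs]
        · have : s⁻¹ * u ∈ T := Finset.mem_image₂_of_mem (by simpa using hs) hu
          simp [hη, this]
    _ ≤ nsq (cnv f η) := ENNReal.sum_le_tsum O
    _ ≤ decayBound (2 * n) * 2 ^ 32 * nsq f * nsq η :=
        nsq_cnv_le_of_tsum_ne_top hf hsymm f1 f2 e1 e2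
    _ ≤ _ := by
        gcongr
        refine ENNReal.tsum_le_tsum fun s => ?_
        simp only [hη]
        gcongr
        split_ifs
        exacts [le_rfl, bot_le]

end GarsideGroup

namespace DualB4

/-- The 14 simple elements of the dual Garside structure of `B₄`; `0` is the identity,
`1, …, 6` are the atoms and `13` is the Garside element. -/
abbrev Simple : Type := Fin 14

/-- The pairs `(t, u)` of simple elements with `s * t = u`, listed for each `s`. -/
def multiples : List (List (Simple × Simple)) := [
  [(0, 0), (1, 1), (2, 2), (3, 3), (4, 4), (5, 5), (6, 6), (7, 7), (8, 8), (9, 9), (10, 10),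
    (11, 11), (12, 12), (13, 13)],
  [(0, 1), (2, 7), (3, 9), (6, 10), (8, 13)],
  [(0, 2), (3, 8), (4, 12), (5, 7), (11, 13)],
  [(0, 3), (1, 9), (4, 11), (6, 8), (10, 13)],
  [(0, 4), (1, 10), (2, 12), (5, 11), (7, 13)],
  [(0, 5), (1, 7), (3, 11), (9, 13)],
  [(0, 6), (2, 8), (4, 10), (12, 13)],
  [(0, 7), (3, 13)],
  [(0, 8), (4, 13)],
  [(0, 9), (6, 13)],
  [(0, 10), (2, 13)],
  [(0, 11), (1, 13)],
  [(0, 12), (5, 13)],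
  [(0, 13)]]

/-- The relation `s * t = u` between simple elements. -/
def IsProd (s t u : Simple) : Prop := (t, u) ∈ multiples.getD s []

instance (s t u : Simple) : Decidable (IsProd s t u) := by unfold IsProd; infer_instance

/-- The first factor of the left-weighted form of the product of two simple elements, as a table. -/
def headTable : List (List Simple) :=
  [[0, 1, 2, 3, 4, 5, 6, 7, 8, 9, 10, 11, 12, 13],
    [1, 1, 7, 9, 1, 1, 10, 7, 13, 9, 10, 9, 7, 13],
    [2, 2, 2, 8, 12, 7, 2, 7, 8, 8, 12, 13, 12, 13],
    [3, 9, 3, 3, 11, 3, 8, 9, 8, 9, 13, 11, 11, 13],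
    [4, 10, 12, 4, 4, 11, 4, 13, 12, 10, 10, 11, 12, 13],
    [5, 7, 5, 11, 5, 5, 5, 7, 11, 13, 7, 11, 5, 13],
    [6, 6, 8, 6, 10, 6, 6, 8, 8, 6, 10, 10, 13, 13],
    [7, 7, 7, 13, 7, 7, 7, 7, 13, 13, 7, 13, 7, 13],
    [8, 8, 8, 8, 13, 8, 8, 8, 8, 8, 13, 13, 13, 13],
    [9, 9, 9, 9, 9, 9, 13, 9, 13, 9, 13, 9, 9, 13],
    [10, 10, 13, 10, 10, 10, 10, 13, 13, 10, 10, 10, 13, 13],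
    [11, 13, 11, 11, 11, 11, 11, 13, 11, 13, 13, 11, 11, 13],
    [12, 12, 12, 12, 12, 13, 12, 13, 12, 12, 12, 13, 12, 13],
    [13, 13, 13, 13, 13, 13, 13, 13, 13, 13, 13, 13, 13, 13]]

/-- The second factor of the left-weighted form of the product of two simple elements. -/
def tailTable : List (List Simple) :=
  [[0, 0, 0, 0, 0, 0, 0, 0, 0, 0, 0, 0, 0, 0],
    [0, 1, 0, 0, 4, 5, 0, 5, 0, 1, 4, 4, 4, 4],
    [0, 1, 2, 0, 0, 0, 6, 1, 6, 1, 1, 0, 2, 1],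
    [0, 0, 2, 3, 0, 5, 0, 2, 2, 3, 0, 5, 2, 2],
    [0, 0, 0, 3, 4, 0, 6, 0, 3, 3, 6, 3, 4, 3],
    [0, 0, 2, 0, 4, 5, 6, 2, 6, 0, 6, 4, 12, 6],
    [0, 1, 0, 3, 0, 5, 6, 5, 3, 9, 1, 5, 0, 5],
    [0, 1, 2, 0, 4, 5, 6, 7, 6, 1, 10, 4, 12, 10],
    [0, 1, 2, 3, 0, 5, 6, 7, 8, 9, 1, 5, 2, 7],
    [0, 1, 2, 3, 4, 5, 0, 7, 2, 9, 4, 11, 12, 12],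
    [0, 1, 0, 3, 4, 5, 6, 5, 3, 9, 10, 11, 4, 11],
    [0, 0, 2, 3, 4, 5, 6, 2, 8, 3, 6, 11, 12, 8],
    [0, 1, 2, 3, 4, 0, 6, 1, 8, 9, 10, 3, 12, 9],
    [0, 1, 2, 3, 4, 5, 6, 7, 8, 9, 10, 11, 12, 13]]

/-- The first factor of the left-weighted form of `s * t`. -/
def hd (s t : Simple) : Simple := (headTable.getD s []).getD t 0

/-- The second factor of the left-weighted form of `s * t`. -/
def tl (s t : Simple) : Simple := (tailTable.getD s []).getD t 0

/-- Left divisibility of simple elements. -/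
def Dvd (s t : Simple) : Prop := ∃ p ∈ multiples.getD s [], p.2 = t

instance (s t : Simple) : Decidable (Dvd s t) := by unfold Dvd; infer_instance

lemma dvd_iff {s t : Simple} : Dvd s t ↔ ∃ r, IsProd s r t :=
  ⟨fun ⟨p, h, e⟩ => ⟨p.1, by rw [IsProd, ← e]; exact h⟩, fun ⟨r, h⟩ => ⟨(r, t), h, rfl⟩⟩

lemma exists_isProd_hd : ∀ s t, ∃ m, IsProd s m (hd s t) ∧ IsProd m (tl s t) t := by
  decide +kernel

lemma hd_mul_aux : ∀ t, ∀ p ∈ multiples.getD (t : Simple) [], ∀ v, hd p.2 v = hd t (hd p.1 v) ∧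
    IsProd (tl t (hd p.1 v)) (tl p.1 v) (tl p.2 v) := by
  decide +kernel

lemma hd_mul {t s u : Simple} (h : IsProd t s u) (v : Simple) : hd u v = hd t (hd s v) ∧
    IsProd (tl t (hd s v)) (tl s v) (tl u v) :=
  hd_mul_aux t (s, u) h v

lemma hd_hd_tl : ∀ s u v, hd u v = u → hd (hd s u) (hd (tl s u) v) = hd s u := by
  decide +kernel

lemma tl_of_hd : ∀ s t, hd s t = s → tl s t = t := by decide +kernel

lemma hd_delta_left : ∀ s, hd 13 s = 13 ∧ tl 13 s = s := by decide +kernel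

lemma hd_delta_right : ∀ s, hd s 13 = 13 := by decide +kernel

lemma tl_delta_four : ∀ s, tl (tl (tl (tl s 13) 13) 13) 13 = s := by decide +kernel

lemma exists_compl_right : ∀ s, ∃ t, IsProd s t 13 := by decide +kernel

lemma exists_compl_left : ∀ s, ∃ t, IsProd t s 13 := by decide +kernel

lemma exists_meet : ∀ s t, ∃ m, Dvd m s ∧ Dvd m t ∧ ∀ u, Dvd u s → Dvd u t → Dvd u m := by
  decide +kernel

lemma dvd_hd : ∀ s t, Dvd s (hd s t) := fun s t =>
  let ⟨m, h, _⟩ := exists_isProd_hd s t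
  dvd_iff.2 ⟨m, h⟩

lemma eq_zero_of_dvd_zero : ∀ s, Dvd s 0 → s = 0 := by decide +kernel

/-- Left multiplication of an infinite word in the simple elements by a simple element. -/
def mulStream : Simple → (ℕ → Simple) → ℕ → Simple
  | s, L, 0 => hd s (L 0)
  | s, L, n + 1 => mulStream (tl s (L 0)) (fun i => L (i + 1)) n

lemma mulStream_mulStream (n : ℕ) : ∀ {t s u : Simple} (_ : IsProd t s u) (L : ℕ → Simple),
    mulStream t (mulStream s L) n = mulStream u L n := by
  induction n with
  | zero => exact fun h L => (hd_mul h (L 0)).1.symm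
  | succ n ih => exact fun h L => ih (hd_mul h (L 0)).2 fun i => L (i + 1)

/-- The infinite words all of whose two-letter subwords are left-weighted. -/
def NormalStream : Type := {L : ℕ → Simple // ∀ i, hd (L i) (L (i + 1)) = L i}

lemma mulStream_normal (n : ℕ) : ∀ (s : Simple) (L : ℕ → Simple)
    (_ : ∀ i, hd (L i) (L (i + 1)) = L i),
    hd (mulStream s L n) (mulStream s L (n + 1)) = mulStream s L n := by
  induction n with
  | zero => exact fun s L h => hd_hd_tl s (L 0) (L 1) (h 0)
  | succ n ih => exact fun s L h => ih _ _ fun i => h (i + 1)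

lemma mulStream_tail (n : ℕ) : ∀ (L : ℕ → Simple) (_ : ∀ i, hd (L i) (L (i + 1)) = L i),
    mulStream (L 0) (fun i => L (i + 1)) n = L n := by
  induction n with
  | zero => exact fun L h => h 0
  | succ n ih =>
    intro L h
    rw [mulStream, tl_of_hd _ _ (h 0)]
    exact ih (fun i => L (i + 1)) fun i => h (i + 1)

namespace NormalStream

/-- Left multiplication of a normal infinite word. -/
def mul (s : Simple) (L : NormalStream) : NormalStream :=
  ⟨mulStream s L.1, fun i => mulStream_normal i s L.1 L.2⟩

lemma mul_mul {t s u : Simple} (h : IsProd t s u) (L : NormalStream) :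
    mul t (mul s L) = mul u L :=
  Subtype.ext (funext fun n => mulStream_mulStream n h L.1)

/-- Left multiplication by the Garside element. -/
def shift (L : NormalStream) : NormalStream := mul 13 L

lemma shift_zero (L : NormalStream) : (shift L).1 0 = 13 := (hd_delta_left _).1

lemma shift_succ (L : NormalStream) (n : ℕ) : (shift L).1 (n + 1) = L.1 n := by
  have : (shift L).1 (n + 1) = mulStream (L.1 0) (fun i => L.1 (i + 1)) n := by
    rw [← (hd_delta_left (L.1 0)).2]; rfl
  rw [this]
  exact mulStream_tail n L.1 L.2

lemma mul_shift (s : Simple) (L : NormalStream) : mul s (shift L) = shift (mul (tl s 13) L) := by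
  refine Subtype.ext (funext fun n => ?_)
  cases n with
  | zero =>
    rw [shift_zero]
    exact (congrArg (hd s) (shift_zero L)).trans (hd_delta_right s)
  | succ n =>
    rw [shift_succ]
    change mulStream (tl s ((shift L).1 0)) (fun i => (shift L).1 (i + 1)) n = _
    simp_rw [shift_zero, shift_succ]
    rfl

/-- Left multiplication by the fourth power of the Garside element. -/
def shift4 (L : NormalStream) : NormalStream := shift (shift (shift (shift L)))

lemma mul_shift4 (s : Simple) (L : NormalStream) : mul s (shift4 L) = shift4 (mul s L) := by
  simp only [shift4, mul_shift]
  rw [tl_delta_four]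

lemma shift4_apply (L : NormalStream) (n : ℕ) : (shift4 L).1 (n + 4) = L.1 n := by
  rw [shift4, shift_succ, shift_succ, shift_succ, shift_succ]

end NormalStream

open NormalStream

/-- The relation identifying `(L, k)` with `(δ⁴ L, k + 1)`. -/
def shiftRel (p q : NormalStream × ℤ) : Prop := q = (shift4 p.1, p.2 + 1)

/-- The set on which the braid group acts: formal quotients of normal
forms by powers of `δ ^ 4`. -/
def Frac : Type := Quot shiftRel

namespace Frac

/-- The action of a simple element. -/
def smul (s : Simple) : Frac → Frac :=
  Quot.map (fun p => (mul s p.1, p.2)) fun p q h => by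
    subst h
    simp only [shiftRel, mul_shift4]

lemma smul_mk (s : Simple) (L : NormalStream) (k : ℤ) :
    smul s (Quot.mk _ (L, k)) = Quot.mk _ (mul s L, k) := rfl

lemma smul_smul {t s u : Simple} (h : IsProd t s u) (ω : Frac) :
    smul t (smul s ω) = smul u ω := by
  induction ω using Quot.ind with
  | mk p =>
    rw [smul_mk, smul_mk, mul_mul h, smul_mk]

lemma smul_delta_four (L : NormalStream) (k : ℤ) :
    smul 13 (smul 13 (smul 13 (smul 13 (Quot.mk _ (L, k + 1))))) = Quot.mk _ (L, k) :=
  (Quot.sound rfl : Quot.mk shiftRel (L, k) = Quot.mk _ (shift4 L, k + 1)).symm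

lemma smul_delta_bijective : Function.Bijective (smul 13) := by
  constructor
  · have h : Function.Injective (smul 13 ∘ smul 13 ∘ smul 13 ∘ smul 13) := by
      intro p q
      induction p using Quot.ind with
      | mk p =>
      induction q using Quot.ind with
      | mk q =>
      obtain ⟨L, k⟩ := p
      obtain ⟨M, l⟩ := q
      intro h
      have e1 := smul_delta_four L (k - 1)
      have e2 := smul_delta_four M (l - 1)
      rw [sub_add_cancel] at e1 e2
      have h2 : (Quot.mk shiftRel (L, k - 1)) = Quot.mk _ (M, l - 1) := by
        rw [← e1, ← e2]; exact h
      have h3 : Quot.map (fun p : NormalStream × ℤ => (p.1, p.2 + 1)) (rb := shiftRel)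
          (fun p q h => by subst h; simp only [shiftRel]) (Quot.mk shiftRel (L, k - 1)) =
          Quot.map (fun p : NormalStream × ℤ => (p.1, p.2 + 1)) (rb := shiftRel)
          (fun p q h => by subst h; simp only [shiftRel]) (Quot.mk shiftRel (M, l - 1)) := by
        rw [h2]
      have h4 : (Quot.mk shiftRel (L, k)) = Quot.mk shiftRel (M, l) := by
        simpa [Quot.map] using h3
      exact h4
    exact Function.Injective.of_comp (f := smul 13 ∘ smul 13 ∘ smul 13) h
  · intro p
    induction p using Quot.ind with
    | mk p => exact ⟨_, smul_delta_four p.1 p.2⟩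

lemma smul_bijective (s : Simple) : Function.Bijective (smul s) := by
  obtain ⟨t, ht⟩ := exists_compl_right s
  obtain ⟨r, hr⟩ := exists_compl_left s
  constructor
  · refine Function.Injective.of_comp (f := smul r) ?_
    have : smul r ∘ smul s = smul 13 := funext fun ω => smul_smul hr ω
    rw [this]
    exact smul_delta_bijective.1
  · refine Function.Surjective.of_comp (g := smul t) ?_
    have : smul s ∘ smul t = smul 13 := funext fun ω => smul_smul ht ω
    rw [this]
    exact smul_delta_bijective.2

/-- The permutation given by the action of a simple element. -/
noncomputable def perm (s : Simple) : Equiv.Perm Frac := Equiv.ofBijective _ (smul_bijective s)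

lemma perm_mul {t s u : Simple} (h : IsProd t s u) : perm t * perm s = perm u :=
  Equiv.ext fun ω => smul_smul h ω

/-- The first letter of the fraction. -/
def head : Frac → Simple :=
  Quot.lift (fun p => if p.2 < 0 then 13 else p.1.1 (4 * p.2).toNat) fun p q h => by
    subst h
    obtain ⟨L, k⟩ := p
    by_cases h : k < 0
    · by_cases h' : k + 1 < 0
      · simp [h, h']
      · have : k = -1 := by omega
        subst this
        exact (shift_zero _).symm
    · have h' : ¬ k + 1 < 0 := by omega
      have e : (4 * (k + 1)).toNat = (4 * k).toNat + 4 := by omega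
      simp only [h, h', if_false, e, shift4_apply]

/-- The base point of the action. -/
def base : Frac := Quot.mk _ (⟨fun _ => 0, fun _ => rfl⟩, 0)

/-- The fractions with denominator one. -/
def Positive (ω : Frac) : Prop := ∃ L, ω = Quot.mk _ (L, 0)

lemma positive_base : Positive base := ⟨_, rfl⟩

lemma head_base : head base = 0 := rfl

lemma Positive.smul {ω : Frac} (h : Positive ω) (s : Simple) : Positive (smul s ω) := by
  obtain ⟨L, rfl⟩ := h
  exact ⟨_, rfl⟩

lemma head_smul {ω : Frac} (h : Positive ω) (s : Simple) : head (smul s ω) = hd s (head ω) := by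
  obtain ⟨L, rfl⟩ := h
  rfl

end Frac

lemma a_b_a : a * b * a = b * a * b := by
  have : (PresentedGroup.mk braidRels4 _ : B4) = 1 := PresentedGroup.one_of_mem (Or.inl rfl)
  rw [map_mul, map_inv, mul_inv_eq_one] at this
  simp only [map_mul] at this
  exact this

lemma b_c_b : b * c * b = c * b * c := by
  have : (PresentedGroup.mk braidRels4 _ : B4) = 1 :=
    PresentedGroup.one_of_mem (Or.inr (Or.inl rfl))
  rw [map_mul, map_inv, mul_inv_eq_one] at this
  simp only [map_mul] at this
  exact this

lemma c_a : c * a = a * c := by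
  have : (PresentedGroup.mk braidRels4 _ : B4) = 1 :=
    PresentedGroup.one_of_mem (Or.inr (Or.inr rfl))
  rw [map_mul, map_inv, mul_inv_eq_one] at this
  simp only [map_mul] at this
  exact this.symm

/-- The half twist of the first and third strand. -/
def a₁₃ : B4 := a * b * a⁻¹

/-- The half twist of the second and fourth strand. -/
def a₂₄ : B4 := b * c * b⁻¹

/-- The half twist of the first and fourth strand. -/
def a₁₄ : B4 := a * a₂₄ * a⁻¹

lemma a₁₃_a : a₁₃ * a = a * b := by simp [a₁₃]

lemma b_a₁₃ : b * a₁₃ = a * b := by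
  rw [a₁₃, ← mul_assoc, ← mul_assoc, ← a_b_a, mul_inv_cancel_right]

lemma a₂₄_b : a₂₄ * b = b * c := by simp [a₂₄]

lemma c_a₂₄ : c * a₂₄ = b * c := by
  rw [a₂₄, ← mul_assoc, ← mul_assoc, ← b_c_b, mul_inv_cancel_right]

lemma a₁₄_a : a₁₄ * a = a * a₂₄ := by simp [a₁₄]

lemma b_c_a₁₄ : b * c * a₁₄ = a * b * c := by
  rw [← mul_left_inj a, mul_assoc _ _ a, a₁₄_a, ← mul_left_inj b]
  calc b * c * (a * a₂₄) * b = b * (c * a) * (a₂₄ * b) := by group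
    _ = b * a * (c * b * c) := by rw [c_a, a₂₄_b]; group
    _ = (b * a * b) * c * b := by rw [← b_c_b]; group
    _ = a * b * (a * c) * b := by rw [← a_b_a]; group
    _ = a * b * c * a * b := by rw [← c_a]; group

lemma a_a₂₄_b : a * a₂₄ * b = a * b * c := by rw [mul_assoc, a₂₄_b, mul_assoc]

lemma a₁₄_a_b : a₁₄ * a * b = a * b * c := by rw [a₁₄_a, a_a₂₄_b]

lemma a₂₄_a₁₄ : a₂₄ * a₁₄ = a * a₂₄ := by
  rw [← mul_right_inj c, ← mul_assoc, c_a₂₄, b_c_a₁₄, ← mul_assoc, c_a, mul_assoc, mul_assoc,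
    c_a₂₄]

lemma a₁₃_c : a₁₃ * c = c * a₁₄ := by
  rw [← mul_right_inj b, ← mul_assoc, b_a₁₃, ← mul_assoc, b_c_a₁₄]

lemma a₁₄_a₁₃ : a₁₄ * a₁₃ = c * a₁₄ := by
  rw [← mul_left_inj a, mul_assoc, a₁₃_a, ← mul_assoc, a₁₄_a_b, mul_assoc c, a₁₄_a,
    ← mul_assoc, c_a, mul_assoc a c, c_a₂₄, mul_assoc]

lemma a₁₄_b : a₁₄ * b = b * a₁₄ := by
  rw [← mul_left_inj a₁₃, mul_assoc, b_a₁₃, ← mul_assoc, a₁₄_a_b, mul_assoc b, a₁₄_a₁₃,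
    ← mul_assoc, b_c_a₁₄]

/-- The simple elements as elements of the braid group. -/
def simple : Simple → B4 := ![1, a, b, c, a₁₄, a₁₃, a₂₄, a * b, b * c, a * c, a * a₂₄, c * a₁₄,
  b * a₁₄, a * b * c]

lemma simple_mul_aux : ∀ t, ∀ p ∈ multiples.getD (t : Simple) [],
    simple t * simple p.1 = simple p.2 := by
  intro t
  fin_cases t <;> simp [multiples, simple]
  · exact (mul_assoc _ _ _).symm
  · exact ⟨b_a₁₃, by rw [← mul_assoc, b_c_a₁₄]⟩
  · exact ⟨c_a, c_a₂₄, by rw [← mul_assoc, c_a, mul_assoc, c_a₂₄, mul_assoc]⟩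
  · exact ⟨a₁₄_a, a₁₄_b, a₁₄_a₁₃, by rw [← mul_assoc, a₁₄_a_b]⟩
  · exact ⟨a₁₃_a, a₁₃_c, by rw [← mul_assoc, a₁₃_a]⟩
  · exact ⟨a₂₄_b, a₂₄_a₁₄, by rw [← mul_assoc, a₂₄_b, b_c_a₁₄]⟩
  · exact b_c_a₁₄
  · rw [mul_assoc, c_a₂₄, mul_assoc]
  · exact a_a₂₄_b
  · rw [mul_assoc, a₁₄_a, ← mul_assoc, c_a, mul_assoc, c_a₂₄, mul_assoc]
  · rw [mul_assoc, a₁₄_a₁₃, ← mul_assoc, b_c_a₁₄]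

lemma simple_mul {s t u : Simple} (h : IsProd s t u) : simple s * simple t = simple u :=
  simple_mul_aux s (t, u) h

lemma simple_mul_simple (s t : Simple) :
    simple s * simple t = simple (hd s t) * simple (tl s t) := by
  obtain ⟨m, h1, h2⟩ := exists_isProd_hd s t
  rw [← simple_mul h1, ← simple_mul h2, mul_assoc]

/-- The exponent sum of a braid. -/
def expSum : B4 →* Multiplicative ℤ :=
  PresentedGroup.toGroup (f := fun _ => Multiplicative.ofAdd 1) (by
    rintro r (rfl | rfl | rfl) <;> simp)

/-- The exponent sum of a braid as an integer. -/
def blen (g : B4) : ℤ := (expSum g).toAdd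

lemma blen_mul (g h : B4) : blen (g * h) = blen g + blen h := by simp [blen]

lemma blen_one : blen 1 = 0 := by simp [blen]

lemma blen_inv (g : B4) : blen g⁻¹ = -blen g := by simp [blen]

lemma blen_a : blen a = 1 := by simp [blen, a, expSum]

lemma blen_b : blen b = 1 := by simp [blen, b, expSum]

lemma blen_c : blen c = 1 := by simp [blen, c, expSum]

lemma blen_simple (s : Simple) :
    blen (simple s) = (![0, 1, 1, 1, 1, 1, 1, 2, 2, 2, 2, 2, 2, 3] : Simple → ℤ) s := by
  fin_cases s <;> simp [simple, a₁₄, a₁₃, a₂₄, blen_mul, blen_a, blen_b, blen_c, blen_one, blen_inv]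

lemma blen_simple_pos {s : Simple} (h : s ≠ 0) : 0 < blen (simple s) := by
  rw [blen_simple]
  revert s
  decide

lemma perm_zero : Frac.perm 0 = 1 :=
  mul_left_cancel (a := Frac.perm 0) (by rw [mul_one]; exact Frac.perm_mul (by decide))

/-- The action of the braid group on fractions. -/
noncomputable def action : B4 →* Equiv.Perm Frac :=
  PresentedGroup.toGroup (f := ![Frac.perm 1, Frac.perm 2, Frac.perm 3]) (by
    have h (s t u : Simple) (h : IsProd s t u := by decide) := Frac.perm_mul h
    rintro r (rfl | rfl | rfl)
    · simp only [map_mul, map_inv, FreeGroup.lift_apply_of, mul_inv_eq_one]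
      change Frac.perm 1 * Frac.perm 2 * Frac.perm 1 = Frac.perm 2 * Frac.perm 1 * Frac.perm 2
      rw [h 1 2 7, ← h 2 5 7, mul_assoc, h 5 1 7, ← h 1 2 7, mul_assoc]
    · simp only [map_mul, map_inv, FreeGroup.lift_apply_of, mul_inv_eq_one]
      change Frac.perm 2 * Frac.perm 3 * Frac.perm 2 = Frac.perm 3 * Frac.perm 2 * Frac.perm 3
      rw [h 2 3 8, ← h 3 6 8, mul_assoc, h 6 2 8, ← h 2 3 8, mul_assoc]
    · simp only [map_mul, map_inv, FreeGroup.lift_apply_of, mul_inv_eq_one]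
      change Frac.perm 1 * Frac.perm 3 = Frac.perm 3 * Frac.perm 1
      rw [h 1 3 9, h 3 1 9])

lemma action_simple (s : Simple) : action (simple s) = Frac.perm s := by
  have h (s t u : Simple) (h : IsProd s t u := by decide) := Frac.perm_mul h
  have ha : action a = Frac.perm 1 := by simp [action, a]
  have hb : action b = Frac.perm 2 := by simp [action, b]
  have hc : action c = Frac.perm 3 := by simp [action, c]
  have h5 : action a₁₃ = Frac.perm 5 := by
    rw [a₁₃, map_mul, map_mul, map_inv, ha, hb, h 1 2 7, ← h 5 1 7, mul_inv_cancel_right]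
  have h6 : action a₂₄ = Frac.perm 6 := by
    rw [a₂₄, map_mul, map_mul, map_inv, hb, hc, h 2 3 8, ← h 6 2 8, mul_inv_cancel_right]
  have h4 : action a₁₄ = Frac.perm 4 := by
    rw [a₁₄, map_mul, map_mul, map_inv, ha, h6, h 1 6 10, ← h 4 1 10, mul_inv_cancel_right]
  fin_cases s <;>
    simp [simple, ha, hb, hc, h4, h5, h6, perm_zero, h 1 2 7, h 2 3 8, h 1 3 9, h 1 6 10, h 3 4 11,
      h 2 4 12, h 7 3 13]

/-- The monoid of dual positive braids. -/
def pos : Submonoid B4 := Submonoid.closure (Set.range simple)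

lemma simple_mem (s : Simple) : simple s ∈ pos := Submonoid.subset_closure ⟨s, rfl⟩

lemma pos_induction {p : B4 → Prop} (one : p 1)
    (mul : ∀ s g, g ∈ pos → p g → p (simple s * g)) {g : B4} (hg : g ∈ pos) : p g := by
  induction hg using Submonoid.closure_induction_left with
  | one => exact one
  | mul_left x hx y hy ih =>
    obtain ⟨s, rfl⟩ := hx
    exact mul s y hy ih

/-- The maximal simple left divisor of a positive braid. -/
noncomputable def head (g : B4) : Simple := (action g Frac.base).head

lemma positive_action {g : B4} (hg : g ∈ pos) : (action g Frac.base).Positive := by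
  refine pos_induction (p := fun g => (action g Frac.base).Positive) ?_ ?_ hg
  · rw [map_one]; exact Frac.positive_base
  · intro s g _ h
    rw [map_mul, action_simple]
    exact h.smul s

lemma head_one : head 1 = 0 := by
  rw [head, map_one]
  exact Frac.head_base

lemma head_simple_mul {g : B4} (hg : g ∈ pos) (s : Simple) :
    head (simple s * g) = hd s (head g) := by
  rw [head, map_mul, action_simple]
  exact Frac.head_smul (positive_action hg) s

lemma head_dvd {g : B4} (hg : g ∈ pos) : (simple (head g))⁻¹ * g ∈ pos := by
  refine pos_induction (p := fun g => (simple (head g))⁻¹ * g ∈ pos) ?_ ?_ hg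
  · rw [head_one]; simp [simple]
  · intro s g hg ih
    rw [head_simple_mul hg]
    have : (simple (hd s (head g)))⁻¹ * (simple s * g) =
        simple (tl s (head g)) * ((simple (head g))⁻¹ * g) := by
      rw [inv_mul_eq_iff_eq_mul, ← mul_assoc, ← simple_mul_simple]
      group
    rw [this]
    exact mul_mem (simple_mem _) ih

lemma simple_dvd_iff {g : B4} (hg : g ∈ pos) {s : Simple} :
    (simple s)⁻¹ * g ∈ pos ↔ Dvd s (head g) := by
  constructor
  · intro h
    have := head_simple_mul h s
    rw [mul_inv_cancel_left] at this
    rw [this]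
    exact dvd_hd _ _
  · intro h
    obtain ⟨r, h⟩ := dvd_iff.1 h
    have e : (simple s)⁻¹ * g = simple r * ((simple (head g))⁻¹ * g) := by
      rw [← simple_mul h]; group
    rw [e]
    exact mul_mem (simple_mem _) (head_dvd hg)

lemma simple_zero : simple 0 = 1 := rfl

lemma blen_nonneg {g : B4} (hg : g ∈ pos) : 0 ≤ blen g := by
  refine pos_induction (p := fun g => 0 ≤ blen g) blen_one.ge ?_ hg
  intro s g _ h
  rw [blen_mul]
  rcases eq_or_ne s 0 with rfl | hs
  · rwa [simple_zero, blen_one, zero_add]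
  · exact add_nonneg (blen_simple_pos hs).le h

lemma eq_one_of_blen {g : B4} (hg : g ∈ pos) : blen g ≤ 0 → g = 1 := by
  refine pos_induction (p := fun g => blen g ≤ 0 → g = 1) (fun _ => rfl) ?_ hg
  intro s g hg h
  rw [blen_mul]
  rcases eq_or_ne s 0 with rfl | hs
  · rw [simple_zero, blen_one, zero_add, one_mul]
    exact h
  · have := blen_simple_pos hs
    have := blen_nonneg hg
    omega

lemma eq_one_of_head {g : B4} (hg : g ∈ pos) : head g = 0 → g = 1 := by
  refine pos_induction (p := fun g => head g = 0 → g = 1) (fun _ => rfl) ?_ hg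
  intro s g hg h h0
  rw [head_simple_mul hg] at h0
  have hs := dvd_hd s (head g)
  rw [h0] at hs
  obtain rfl := eq_zero_of_dvd_zero s hs
  rw [← head_simple_mul hg, simple_zero, one_mul] at h0
  rw [h h0, simple_zero, one_mul]

/-- Left divisibility of braids with respect to the dual positive monoid. -/
def Le (g h : B4) : Prop := g⁻¹ * h ∈ pos

lemma le_mul_iff {x g h : B4} : Le (x * g) (x * h) ↔ Le g h := by
  rw [Le, Le]
  group

lemma Le.trans {g h k : B4} (h1 : Le g h) (h2 : Le h k) : Le g k := by
  have := mul_mem h1 h2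
  rwa [mul_assoc, mul_inv_cancel_left] at this

lemma one_le_iff {g : B4} : Le 1 g ↔ g ∈ pos := by simp [Le]

lemma mul_le_iff {x g h : B4} : Le (x * g) h ↔ Le g (x⁻¹ * h) := by
  rw [Le, Le, mul_inv_rev, mul_assoc]

lemma Le.mem {g h : B4} (h1 : Le g h) (hg : g ∈ pos) : h ∈ pos :=
  one_le_iff.1 ((one_le_iff.2 hg).trans h1)

lemma exists_inf_pos (n : ℕ) : ∀ {g h : B4} (_ : g ∈ pos) (_ : h ∈ pos) (_ : blen g ≤ n),
    ∃ m ∈ pos, Le m g ∧ Le m h ∧ ∀ w ∈ pos, Le w g → Le w h → Le w m := by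
  induction n with
  | zero =>
    intro g h hg hh hn
    refine ⟨1, one_mem _, one_le_iff.2 hg, one_le_iff.2 hh, fun w _ h1 _ => ?_⟩
    rwa [eq_one_of_blen hg (by simpa using hn)] at h1
  | succ n ih =>
    intro g h hg hh hn
    obtain ⟨s, hs1, hs2, hs3⟩ := exists_meet (head g) (head h)
    have hsg := (simple_dvd_iff hg).2 hs1
    have hsh := (simple_dvd_iff hh).2 hs2
    have hw : ∀ w ∈ pos, Le w g → Le w h → Dvd (head w) s := fun w hw h1 h2 =>
      hs3 _ ((simple_dvd_iff hg).1 (Le.trans (head_dvd hw) h1))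
        ((simple_dvd_iff hh).1 (Le.trans (head_dvd hw) h2))
    rcases eq_or_ne s 0 with rfl | hs
    · refine ⟨1, one_mem _, one_le_iff.2 hg, one_le_iff.2 hh, fun w hw' h1 h2 => ?_⟩
      rw [eq_one_of_head hw' (eq_zero_of_dvd_zero _ (hw w hw' h1 h2))]
      exact one_le_iff.2 (one_mem _)
    · have hlen : ∀ {t : Simple}, t ≠ 0 → blen ((simple t)⁻¹ * g) ≤ n := fun {t} ht => by
        have := blen_simple_pos ht
        rw [blen_mul, blen_inv]
        push_cast at hn
        omega
      obtain ⟨m, hm, hm1, hm2, hm3⟩ := ih hsg hsh (hlen hs)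
      refine ⟨simple s * m, mul_mem (simple_mem s) hm, mul_le_iff.2 hm1, mul_le_iff.2 hm2,
        fun w hw' h1 h2 => ?_⟩
      rcases eq_or_ne (head w) 0 with h0 | h0
      · rw [eq_one_of_head hw' h0]
        exact one_le_iff.2 (mul_mem (simple_mem s) hm)
      · obtain ⟨r, hr⟩ := dvd_iff.1 (hw w hw' h1 h2)
        have hr' := simple_mul hr
        set t := head w
        have d1 : Le (simple r) ((simple t)⁻¹ * g) := by
          rw [← mul_le_iff, hr']; exact hsg
        have d2 : Le (simple r) ((simple t)⁻¹ * h) := by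
          rw [← mul_le_iff, hr']; exact hsh
        obtain ⟨e, he, he1, he2, he3⟩ :=
          ih (d1.mem (simple_mem r)) (d2.mem (simple_mem r)) (hlen h0)
        have hre := he3 _ (simple_mem r) d1 d2
        have hem : Le ((simple r)⁻¹ * e) m := by
          refine hm3 _ hre ?_ ?_
          · rw [← hr', mul_inv_rev, mul_assoc, le_mul_iff]; exact he1
          · rw [← hr', mul_inv_rev, mul_assoc, le_mul_iff]; exact he2
        have hwe : Le ((simple t)⁻¹ * w) e := by
          refine he3 _ (head_dvd hw') ?_ ?_
          · rwa [le_mul_iff]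
          · rwa [le_mul_iff]
        have h3 : Le ((simple t)⁻¹ * w) (simple r * m) := hwe.trans (by
          rw [← le_mul_iff (x := (simple r)⁻¹), inv_mul_cancel_left]; exact hem)
        rw [← le_mul_iff (x := simple t), mul_inv_cancel_left, ← mul_assoc, hr'] at h3
        exact h3

/-- The Garside element. -/
def δ : B4 := a * b * c

lemma simple_last : simple 13 = δ := rfl

lemma blen_delta : blen δ = 3 := by rw [← simple_last, blen_simple]; rfl

lemma conj_delta_simple (s : Simple) : δ⁻¹ * simple s * δ ∈ pos := by
  obtain ⟨t, ht⟩ := exists_compl_right s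
  obtain ⟨r, hr⟩ := exists_compl_right t
  have h1 := simple_mul ht
  have h2 := simple_mul hr
  rw [simple_last] at h1 h2
  have : δ⁻¹ * simple s * δ = simple r := by
    nth_rw 2 [← h2]
    rw [mul_assoc, ← mul_assoc (simple s), h1, inv_mul_cancel_left]
  rw [this]
  exact simple_mem r

lemma conj_delta_inv_simple (s : Simple) : δ * simple s * δ⁻¹ ∈ pos := by
  obtain ⟨t, ht⟩ := exists_compl_left s
  obtain ⟨r, hr⟩ := exists_compl_left t
  have h1 := simple_mul ht
  have h2 := simple_mul hr
  rw [simple_last] at h1 h2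
  have : δ * simple s * δ⁻¹ = simple r := by
    nth_rw 1 [← h2]
    rw [mul_assoc (simple r), h1, mul_inv_cancel_right]
  rw [this]
  exact simple_mem r

lemma conj_delta {g : B4} (hg : g ∈ pos) : δ⁻¹ * g * δ ∈ pos := by
  refine pos_induction (p := fun g => δ⁻¹ * g * δ ∈ pos) (by simp) ?_ hg
  intro s g _ h
  have := mul_mem (conj_delta_simple s) h
  convert this using 1
  group

lemma conj_delta_inv {g : B4} (hg : g ∈ pos) : δ * g * δ⁻¹ ∈ pos := by
  refine pos_induction (p := fun g => δ * g * δ⁻¹ ∈ pos) (by simp) ?_ hg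
  intro s g _ h
  have := mul_mem (conj_delta_inv_simple s) h
  convert this using 1
  group

lemma conj_delta_pow {g : B4} (hg : g ∈ pos) (n : ℕ) :
    δ ^ (-n : ℤ) * g * δ ^ (n : ℤ) ∈ pos ∧ δ ^ (n : ℤ) * g * δ ^ (-n : ℤ) ∈ pos := by
  induction n with
  | zero => simpa using hg
  | succ n ih =>
    constructor
    · convert conj_delta ih.1 using 1
      push_cast
      group
    · convert conj_delta_inv ih.2 using 1
      push_cast
      group

lemma conj_delta_zpow {g : B4} (n : ℤ) : δ ^ (-n) * g * δ ^ n ∈ pos ↔ g ∈ pos := by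
  have h : ∀ (n : ℤ) (g : B4), g ∈ pos → δ ^ (-n) * g * δ ^ n ∈ pos := by
    intro n g hg
    obtain ⟨k, rfl | rfl⟩ := n.eq_nat_or_neg
    · exact (conj_delta_pow hg k).1
    · rw [neg_neg]
      exact (conj_delta_pow hg k).2
  refine ⟨fun hg => ?_, h n g⟩
  convert h (-n) _ hg using 1
  group

lemma delta_pow_mem (n : ℕ) : δ ^ n ∈ pos := pow_mem (simple_mem 13) n

lemma exists_mul_delta_pow_mul {x y : B4} (hx : ∃ n : ℕ, x * δ ^ n ∈ pos)
    (hy : ∃ n : ℕ, y * δ ^ n ∈ pos) : ∃ n : ℕ, x * y * δ ^ n ∈ pos := by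
  obtain ⟨n, hn⟩ := hx
  obtain ⟨m, hm⟩ := hy
  refine ⟨n + m, ?_⟩
  have := mul_mem hn ((conj_delta_zpow n).2 hm)
  convert this using 1
  simp only [zpow_natCast, zpow_neg, pow_add, (Commute.refl δ).pow_pow n m |>.eq]
  group

lemma exists_mul_delta_pow (g : B4) : ∃ n : ℕ, g * δ ^ n ∈ pos := by
  have hg : g ∈ Subgroup.closure (Set.range (PresentedGroup.of (rels := braidRels4))) := by
    rw [PresentedGroup.closure_range_of]; trivial
  have h1 : ∀ x ∈ Set.range (PresentedGroup.of (rels := braidRels4)), ∃ s, simple s = x := by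
    rintro _ ⟨i, rfl⟩
    fin_cases i
    exacts [⟨1, rfl⟩, ⟨2, rfl⟩, ⟨3, rfl⟩]
  refine And.left (b := ∃ n : ℕ, g⁻¹ * δ ^ n ∈ pos) ?_
  induction hg using Subgroup.closure_induction with
  | mem x hx =>
    obtain ⟨s, rfl⟩ := h1 x hx
    obtain ⟨t, ht⟩ := exists_compl_right s
    refine ⟨⟨0, by simpa using simple_mem s⟩, 1, ?_⟩
    rw [pow_one, ← simple_last, ← simple_mul ht, inv_mul_cancel_left]
    exact simple_mem t
  | one => exact ⟨⟨0, by simp⟩, 0, by simp⟩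
  | mul x y _ _ hx hy =>
    rw [mul_inv_rev]
    exact ⟨exists_mul_delta_pow_mul hx.1 hy.1, exists_mul_delta_pow_mul hy.2 hx.2⟩
  | inv x _ ih => rw [inv_inv]; exact ih.symm

lemma Le.refl (g : B4) : Le g g := by simp [Le, one_mem]

lemma Le.blen_le {g h : B4} (h1 : Le g h) : blen g ≤ blen h := by
  have := blen_nonneg h1
  rw [blen_mul, blen_inv] at this
  omega

lemma Le.eq_of_blen {g h : B4} (h1 : Le g h) (h2 : blen h ≤ blen g) : g = h := by
  have := eq_one_of_blen h1 (by rw [blen_mul, blen_inv]; omega)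
  rwa [inv_mul_eq_one] at this

lemma exists_le_mul_delta_pow (g h : B4) : ∃ n : ℕ, ∀ k, n ≤ k → Le g (h * δ ^ k) := by
  obtain ⟨n, hn⟩ := exists_mul_delta_pow (g⁻¹ * h)
  refine ⟨n, fun k hk => ?_⟩
  obtain ⟨m, rfl⟩ := Nat.exists_eq_add_of_le hk
  have := mul_mem hn (delta_pow_mem m)
  rwa [mul_assoc, ← pow_add, mul_assoc] at this

lemma exists_delta_le (g : B4) : ∃ n : ℕ, ∀ k, n ≤ k → Le (δ ^ (-k : ℤ)) g := by
  obtain ⟨n, hn⟩ := exists_le_mul_delta_pow 1 g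
  refine ⟨n, fun k hk => ?_⟩
  have := (conj_delta_zpow (-k : ℤ)).2 (one_le_iff.1 (hn k hk))
  rw [Le]
  convert this using 1
  rw [← zpow_natCast]
  group

lemma exists_lower (g h k : B4) : ∃ e, Le e g ∧ Le e h ∧ Le e k := by
  obtain ⟨n1, h1⟩ := exists_delta_le g
  obtain ⟨n2, h2⟩ := exists_delta_le h
  obtain ⟨n3, h3⟩ := exists_delta_le k
  exact ⟨δ ^ (-(max n1 (max n2 n3) : ℕ) : ℤ), h1 _ (by omega), h2 _ (by omega), h3 _ (by omega)⟩

lemma exists_inf_of_lower {e g h : B4} (hg : Le e g) (hh : Le e h) :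
    ∃ m, Le e m ∧ Le m g ∧ Le m h ∧ ∀ w, Le e w → Le w g → Le w h → Le w m := by
  obtain ⟨m, hm, h1, h2, h3⟩ := exists_inf_pos (blen (e⁻¹ * g)).toNat hg hh (Int.self_le_toNat _)
  refine ⟨e * m, by simpa [Le], mul_le_iff.2 h1, mul_le_iff.2 h2, fun w hw hwg hwh => ?_⟩
  have := h3 _ hw (le_mul_iff.2 hwg) (le_mul_iff.2 hwh)
  rwa [← le_mul_iff (x := e), mul_inv_cancel_left] at this

lemma exists_inf (g h : B4) : ∃ m, Le m g ∧ Le m h ∧ ∀ w, Le w g → Le w h → Le w m := by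
  obtain ⟨e, hg, hh, _⟩ := exists_lower g h g
  obtain ⟨m, hm, h1, h2, h3⟩ := exists_inf_of_lower hg hh
  refine ⟨m, h1, h2, fun w hwg hwh => ?_⟩
  obtain ⟨e', he, he', _⟩ := exists_lower e w e
  obtain ⟨m', _, h1', h2', h3'⟩ := exists_inf_of_lower (he.trans hg) (he.trans hh)
  exact (h3' w he' hwg hwh).trans (h3 m' (h3' e he hg hh) h1' h2')

lemma exists_sup (g h : B4) : ∃ m, Le g m ∧ Le h m ∧ ∀ w, Le g w → Le h w → Le m w := by
  obtain ⟨n, hn⟩ := exists_le_mul_delta_pow h g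
  obtain ⟨k, ⟨m, hgm, hhm, rfl⟩, hk⟩ := Int.exists_least_of_bdd
    (P := fun k => ∃ m, Le g m ∧ Le h m ∧ blen m = k)
    ⟨blen g, fun _ ⟨_, hm, _, e⟩ => e ▸ hm.blen_le⟩
    ⟨_, g * δ ^ n, by simpa [Le] using delta_pow_mem n, hn n le_rfl, rfl⟩
  refine ⟨m, hgm, hhm, fun w hgw hhw => ?_⟩
  obtain ⟨p, hpm, hpw, hp⟩ := exists_inf m w
  have := hpm.eq_of_blen (hk _ ⟨p, hp _ hgm hgw, hp _ hhm hhw, rfl⟩)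
  rwa [← this]

/-- The Garside structure on the braid group given by its dual positive monoid. -/
noncomputable instance : GarsideGroup B4 where
  toGroup := inferInstance
  le := Le
  le_refl := Le.refl
  le_trans _ _ _ := Le.trans
  le_antisymm _ _ h h' := h.eq_of_blen h'.blen_le
  inf g h := (exists_inf g h).choose
  inf_le_left g h := (exists_inf g h).choose_spec.1
  inf_le_right g h := (exists_inf g h).choose_spec.2.1
  le_inf w g h := (exists_inf g h).choose_spec.2.2 w
  sup g h := (exists_sup g h).choose
  le_sup_left g h := (exists_sup g h).choose_spec.1
  le_sup_right g h := (exists_sup g h).choose_spec.2.1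
  sup_le g h w := (exists_sup g h).choose_spec.2.2 w
  sh g t := g * δ ^ t
  len := blen
  sh_zero := by simp
  sh_sh g s t := by rw [mul_assoc, ← zpow_add]
  sh_mono g h t hgh := by
    have := (conj_delta_zpow t).2 hgh
    change _ ∈ pos
    convert this using 1
    group
  le_sh_one g := by
    change _ ∈ pos
    rw [inv_mul_cancel_left, zpow_one]
    exact simple_mem 13
  len_sh g t := by
    rw [blen_mul, blen, blen, map_zpow, toAdd_zpow, ← blen, ← blen, blen_delta]
    simp [mul_comm]
  len_lt g h hgh := by
    refine lt_of_le_of_ne (Le.blen_le hgh.1) fun h' => hgh.2 ?_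
    rw [Le.eq_of_blen hgh.1 h'.ge]
    exact Le.refl _
  eq_of_inf_sh g w hgw h := by
    by_contra hne
    have hw : g⁻¹ * w ∈ pos := hgw
    set s := head (g⁻¹ * w) with hs
    have hs0 : s ≠ 0 := fun h0 => hne (inv_mul_eq_one.1 (eq_one_of_head hw h0)).symm
    obtain ⟨t, ht⟩ := exists_compl_right s
    have h1 : Le (g * simple s) w := mul_le_iff.2 (head_dvd hw)
    have h2 : Le (g * simple s) (g * δ ^ (1 : ℤ)) := by
      rw [le_mul_iff, zpow_one, ← simple_last, ← simple_mul ht, Le, inv_mul_cancel_left]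
      exact simple_mem t
    have h3 := (exists_inf w (g * δ ^ (1 : ℤ))).choose_spec.2.2 _ h1 h2
    rw [show (exists_inf w (g * δ ^ (1 : ℤ))).choose = g from h] at h3
    have h4 := h3.blen_le
    have h5 := blen_simple_pos hs0
    rw [blen_mul] at h4
    omega
  exists_le_sh g h := by
    obtain ⟨n, hn⟩ := exists_le_mul_delta_pow g h
    exact ⟨n, by simpa using hn n le_rfl⟩
  mul_mono _ _ _ := le_mul_iff.2
  mul_sh g h t := (mul_assoc _ _ _).symm
  len_mul := blen_mul

open GarsideGroup ShiftLattice

lemma near_simple (s : Simple) : Near 1 1 (simple s) := by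
  have h : ∀ g h : B4, lev g h ≤ 1 ↔ Le g (h * δ) := fun g h => by
    rw [← le_sh_iff]
    change Le g (h * δ ^ (1 : ℤ)) ↔ _
    rw [zpow_one]
  obtain ⟨t, ht⟩ := exists_compl_right s
  rw [Near, h, h, one_le_iff, one_mul, ← simple_last]
  refine ⟨mul_mem (simple_mem s) (simple_mem 13), ?_⟩
  rw [← simple_mul ht, Le, inv_mul_cancel_left]
  exact simple_mem t

/-- The generators of the braid group and their inverses. -/
abbrev Letter : Type := {s : B4 // s ∈ SB4 ∨ s⁻¹ ∈ SB4}

instance : Finite Letter := by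
  have h : SB4.Finite := Set.toFinite {a, b, c}
  exact (h.union h.inv).to_subtype

lemma exists_simple_of_mem {s : B4} (hs : s ∈ SB4) : ∃ t, simple t = s := by
  rcases hs with rfl | rfl | rfl
  exacts [⟨1, rfl⟩, ⟨2, rfl⟩, ⟨3, rfl⟩]

lemma near_letter {s : B4} (hs : s ∈ SB4 ∨ s⁻¹ ∈ SB4) : Near 1 1 s := by
  rcases hs with hs | hs
  · obtain ⟨t, rfl⟩ := exists_simple_of_mem hs
    exact near_simple t
  · obtain ⟨t, ht⟩ := exists_simple_of_mem hs
    rw [← inv_inv s, ← ht]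
    exact near_inv (near_simple t)

lemma near_prod (w : List B4) (hw : ∀ s ∈ w, s ∈ SB4 ∨ s⁻¹ ∈ SB4) :
    Near w.length 1 w.prod := by
  induction w with
  | nil => exact ⟨le_sh_iff.1 (le_sh_nat _ 0), le_sh_iff.1 (le_sh_nat _ 0)⟩
  | cons s w ih =>
    rw [List.prod_cons, List.length_cons]
    push_cast
    rw [add_comm]
    exact near_mul (near_letter (hw s (by simp))) (ih fun t ht => hw t (by simp [ht]))

lemma exists_word (x : B4) : ∃ w : List B4, (∀ s ∈ w, s ∈ SB4 ∨ s⁻¹ ∈ SB4) ∧ w.prod = x := by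
  have hg : x ∈ Subgroup.closure SB4 := by
    have h : SB4 = Set.range (PresentedGroup.of (rels := braidRels4)) := by
      ext y
      constructor
      · rintro (rfl | rfl | rfl)
        exacts [⟨0, rfl⟩, ⟨1, rfl⟩, ⟨2, rfl⟩]
      · rintro ⟨i, rfl⟩
        fin_cases i
        exacts [Or.inl rfl, Or.inr (Or.inl rfl), Or.inr (Or.inr rfl)]
    rw [h, PresentedGroup.closure_range_of]
    trivial
  rw [← Subgroup.mem_toSubmonoid, Subgroup.closure_toSubmonoid] at hg
  exact Submonoid.exists_list_of_mem_closure hg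

lemma wordLength_le {w : List B4} (hw : ∀ s ∈ w, s ∈ SB4 ∨ s⁻¹ ∈ SB4) :
    wordLength SB4 w.prod ≤ w.length :=
  Nat.sInf_le ⟨w, rfl, hw, rfl⟩

lemma exists_word_length (x : B4) : ∃ w : List B4, w.length = wordLength SB4 x ∧
    (∀ s ∈ w, s ∈ SB4 ∨ s⁻¹ ∈ SB4) ∧ w.prod = x := by
  obtain ⟨w, hw, hx⟩ := exists_word x
  exact Nat.sInf_mem (s := {n : ℕ | ∃ w : List B4, w.length = n ∧
    (∀ s ∈ w, s ∈ SB4 ∨ s⁻¹ ∈ SB4) ∧ w.prod = x}) ⟨_, w, rfl, hw, hx⟩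

lemma near_wordLength (x : B4) : Near (wordLength SB4 x) 1 x := by
  obtain ⟨w, hl, hw, rfl⟩ := exists_word_length x
  rw [← hl]
  exact near_prod w hw

lemma wordLength_mul_le (x y : B4) :
    wordLength SB4 (x * y) ≤ wordLength SB4 x + wordLength SB4 y := by
  obtain ⟨w, hl, hw, rfl⟩ := exists_word_length x
  obtain ⟨v, hl', hv, rfl⟩ := exists_word_length y
  rw [← hl, ← hl', ← List.length_append, ← List.prod_append]
  refine wordLength_le fun s hs => ?_
  rcases List.mem_append.1 hs with hs | hs
  exacts [hw s hs, hv s hs]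

lemma wordLength_inv_le (x : B4) : wordLength SB4 x⁻¹ ≤ wordLength SB4 x := by
  obtain ⟨w, hl, hw, rfl⟩ := exists_word_length x
  rw [List.prod_inv_reverse, ← hl]
  refine (wordLength_le fun s hs => ?_).trans (by simp)
  simp only [List.mem_reverse, List.mem_map] at hs
  obtain ⟨t, ht, rfl⟩ := hs
  rw [inv_inv]
  exact (hw t ht).symm

lemma wordLength_inv (x : B4) : wordLength SB4 x⁻¹ = wordLength SB4 x :=
  (wordLength_inv_le x).antisymm (by simpa using wordLength_inv_le x⁻¹)

lemma exists_letters {n : ℕ} (x : {x : B4 // wordLength SB4 x = n}) :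
    ∃ f : Fin n → Letter, (List.ofFn fun i => (f i : B4)).prod = x := by
  obtain ⟨x, hx⟩ := x
  obtain ⟨w, hl, hw, rfl⟩ := exists_word_length x
  obtain rfl : w.length = n := hl.trans hx
  exact ⟨fun i => ⟨w.get i, hw _ (List.get_mem w i)⟩, by simp⟩

lemma exists_injective_letters (n : ℕ) :
    ∃ f : {x : B4 // wordLength SB4 x = n} → Fin n → Letter, Function.Injective f := by
  choose f hf using exists_letters (n := n)
  exact ⟨f, fun x y h => Subtype.ext (by rw [← hf, ← hf, h])⟩

instance finite_sphere (n : ℕ) : Finite {x : B4 // wordLength SB4 x = n} :=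
  let ⟨_, hf⟩ := exists_injective_letters n
  Finite.of_injective _ hf

lemma sphereCard_le (n : ℕ) : sphereCard n ≤ Nat.card Letter ^ n := by
  obtain ⟨f, hf⟩ := exists_injective_letters n
  have := Nat.card_le_card_of_injective f hf
  rwa [Nat.card_fun, Nat.card_fin] at this

/-- A product of the braids `a₁₃` and `a₂₄`. -/
def freeWord (w : List Bool) : B4 := (w.map fun i => simple (if i then 5 else 6)).prod

lemma freeWord_cons (i : Bool) (w : List Bool) :
    freeWord (i :: w) = simple (if i then 5 else 6) * freeWord w := by simp [freeWord]

lemma freeWord_mem (w : List Bool) : freeWord w ∈ pos := by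
  refine Submonoid.list_prod_mem _ fun x hx => ?_
  obtain ⟨i, _, rfl⟩ := List.mem_map.1 hx
  exact simple_mem _

lemma hd_free : hd 5 0 = 5 ∧ hd 5 5 = 5 ∧ hd 5 6 = 5 ∧ hd 6 0 = 6 ∧ hd 6 5 = 6 ∧ hd 6 6 = 6 := by
  decide +kernel

lemma head_freeWord_cons (i : Bool) (w : List Bool) :
    head (freeWord (i :: w)) = if i then 5 else 6 := by
  obtain ⟨h1, h2, h3, h4, h5, h6⟩ := hd_free
  induction w generalizing i with
  | nil =>
    rw [freeWord_cons, head_simple_mul (freeWord_mem _), show freeWord [] = 1 from rfl, head_one]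
    cases i <;> simp [h1, h4]
  | cons j w ih =>
    rw [freeWord_cons, head_simple_mul (freeWord_mem _), ih]
    cases i <;> cases j <;> simp [h2, h3, h5, h6]

lemma freeWord_injective : Function.Injective freeWord := by
  have h : ∀ i w, freeWord [] ≠ freeWord (i :: w) := fun i w h => by
    have := head_freeWord_cons i w
    rw [← h, show freeWord [] = 1 from rfl, head_one] at this
    cases i <;> revert this <;> decide
  intro v
  induction v with
  | nil =>
    rintro (_ | ⟨i, w⟩) hw
    exacts [rfl, absurd hw (h i w)]
  | cons j v ih =>
    rintro (_ | ⟨i, w⟩) hw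
    · exact absurd hw.symm (h j v)
    · have h1 := head_freeWord_cons i w
      rw [← hw, head_freeWord_cons] at h1
      obtain rfl : j = i := by cases i <;> cases j <;> first | rfl | (revert h1; decide)
      rw [freeWord_cons, freeWord_cons] at hw
      rw [ih (mul_left_cancel hw)]

lemma wordLength_freeWord_le (w : List Bool) : wordLength SB4 (freeWord w) ≤ 3 * w.length := by
  induction w with
  | nil => exact wordLength_le (w := []) (by simp)
  | cons i w ih =>
    have h : wordLength SB4 (simple (if i then 5 else 6)) ≤ 3 := by
      cases i
      · refine le_of_eq_of_le ?_ (wordLength_le (w := [b, c, b⁻¹]) (by simp [SB4]))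
        simp [simple, a₂₄, mul_assoc]
      · refine le_of_eq_of_le ?_ (wordLength_le (w := [a, b, a⁻¹]) (by simp [SB4]))
        simp [simple, a₁₃, mul_assoc]
    rw [freeWord_cons, List.length_cons]
    have := wordLength_mul_le (simple (if i then 5 else 6)) (freeWord w)
    omega

lemma two_pow_le_sum (n : ℕ) : 2 ^ n ≤ ∑ m ∈ Finset.range (3 * n + 1), sphereCard m := by
  let F : (Fin n → Bool) → Σ m : Fin (3 * n + 1), {x : B4 // wordLength SB4 x = m} := fun v =>
    ⟨⟨wordLength SB4 (freeWord (List.ofFn v)), by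
      have := wordLength_freeWord_le (List.ofFn v)
      rw [List.length_ofFn] at this
      omega⟩, freeWord (List.ofFn v), rfl⟩
  have hF : Function.Injective F := fun v w h => by
    have : (F v).2.1 = (F w).2.1 := by rw [h]
    exact List.ofFn_injective (freeWord_injective this)
  have := Nat.card_le_card_of_injective F hF
  rw [Nat.card_sigma] at this
  simpa [Finset.sum_range, sphereCard] using this

open GarsideGroup ShiftLattice Filter

lemma nsq_enorm (η : lp (fun _ : B4 => ℂ) 2) :
    nsq (fun g => ‖η g‖ₑ) = ENNReal.ofReal (‖η‖ ^ 2) := by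
  have h := lp.hasSum_norm (p := 2) (by norm_num) η
  simp only [ENNReal.toReal_ofNat, Real.rpow_two] at h
  rw [← h.tsum_eq, ENNReal.ofReal_tsum_of_nonneg (fun _ => by positivity) h.summable, nsq]
  refine tsum_congr fun g => ?_
  rw [ENNReal.ofReal_pow (norm_nonneg _), ofReal_norm]

lemma tsum_indicator_sphere (n : ℕ) (f : B4 → ℝ≥0∞) :
    ∑' s, {x | wordLength SB4 x = n}.indicator 1 s * f s =
      ∑' x : {x : B4 // wordLength SB4 x = n}, f x := by
  rw [show (∑' x : {x : B4 // wordLength SB4 x = n}, f x) =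
    ∑' x : {x | wordLength SB4 x = n}, f x from rfl, tsum_subtype]
  refine tsum_congr fun s => ?_
  by_cases hs : wordLength SB4 s = n <;> simp [hs]

lemma nsq_indicator_sphere (n : ℕ) :
    nsq ({x | wordLength SB4 x = n}.indicator (1 : B4 → ℝ≥0∞)) = sphereCard n := by
  have h := tsum_indicator_sphere n ({x | wordLength SB4 x = n}.indicator 1)
  rw [nsq]
  simp_rw [sq]
  rw [h, sphereCard]
  have : Fintype {x : B4 // wordLength SB4 x = n} := Fintype.ofFinite _
  rw [tsum_fintype, Finset.sum_congr rfl fun x _ => Set.indicator_of_mem (by exact x.2) _]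
  simp

variable {n : ℕ} {T : lp (fun _ : B4 => ℂ) 2 →L[ℂ] lp (fun _ : B4 => ℂ) 2}

lemma opNorm_sq_le (hT : ∀ (ξ : lp (fun _ : B4 => ℂ) 2) (g : B4),
    T ξ g = ∑' x : {x : B4 // wordLength SB4 x = n}, ξ ((x : B4)⁻¹ * g)) :
    ‖T‖ ^ 2 ≤ decayBound (2 * n) * 2 ^ 32 * sphereCard n := by
  have h0 : (0 : ℝ) ≤ decayBound (2 * n) * 2 ^ 32 * sphereCard n := by positivity
  refine (Real.le_sqrt (norm_nonneg _) h0).1 (T.opNorm_le_bound (Real.sqrt_nonneg _) fun ξ => ?_)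
  rw [← sq_le_sq₀ (norm_nonneg _) (by positivity), mul_pow, Real.sq_sqrt h0]
  have key := nsq_cnv_le (n := n) (f := {x | wordLength SB4 x = n}.indicator (1 : B4 → ℝ≥0∞))
    (ξ := fun g => ‖ξ g‖ₑ) (fun x hx => ?_) (fun s => ?_) ?_ (fun s => ?_) (fun s => enorm_ne_top)
  · have hle : nsq (fun g => ‖T ξ g‖ₑ) ≤
        nsq (cnv ({x | wordLength SB4 x = n}.indicator (1 : B4 → ℝ≥0∞)) fun g => ‖ξ g‖ₑ) := by
      refine ENNReal.tsum_le_tsum fun g => ?_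
      gcongr
      rw [cnv, tsum_indicator_sphere n fun s => ‖ξ (s⁻¹ * g)‖ₑ]
      change ‖T ξ g‖ₑ ≤ _
      rw [hT]
      exact enorm_tsum_le_tsum_enorm
    have := hle.trans key
    rw [nsq_enorm, nsq_enorm, nsq_indicator_sphere] at this
    rw [← ENNReal.ofReal_le_ofReal_iff (by positivity)]
    refine this.trans (le_of_eq ?_)
    rw [ENNReal.ofReal_mul h0, ENNReal.ofReal_mul (by positivity),
      ENNReal.ofReal_mul (by positivity)]
    simp
  · have : wordLength SB4 x = n := by
      by_contra h
      exact hx (Set.indicator_of_notMem (by exact h) _)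
    exact this ▸ near_wordLength x
  · simp only [Set.indicator_apply, Set.mem_ofPred_eq, wordLength_inv, Pi.one_apply]
  · refine Set.Finite.subset (s := {x | wordLength SB4 x = n}) (finite_sphere n) ?_
    exact Set.support_indicator_subset
  · rw [Set.indicator_apply]
    split_ifs <;> simp

lemma sphereCard_le_opNorm_sq (hT : ∀ (ξ : lp (fun _ : B4 => ℂ) 2) (g : B4),
    T ξ g = ∑' x : {x : B4 // wordLength SB4 x = n}, ξ ((x : B4)⁻¹ * g)) :
    (sphereCard n : ℝ) ≤ ‖T‖ ^ 2 := by
  classical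
  have : Fintype {x : B4 // wordLength SB4 x = n} := Fintype.ofFinite _
  set ξ : lp (fun _ : B4 => ℂ) 2 := lp.single 2 1 1
  have h1 : ∀ y : {x : B4 // wordLength SB4 x = n}, T ξ y = 1 := fun y => by
    rw [hT, tsum_fintype, Finset.sum_eq_single y]
    · rw [inv_mul_cancel]
      exact lp.single_apply_self _ _ _
    · intro x _ hx
      refine lp.single_apply_ne _ _ _ fun h => hx ?_
      exact Subtype.ext (inv_mul_eq_one.1 h)
    · simp
  have h2 := lp.sum_rpow_le_norm_rpow (p := 2) (by norm_num) (T ξ)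
    (Finset.univ.map (Function.Embedding.subtype fun x : B4 => wordLength SB4 x = n))
  have h3 : ‖T ξ‖ ≤ ‖T‖ := by
    refine (T.le_opNorm ξ).trans_eq ?_
    rw [lp.norm_single (by norm_num), norm_one, mul_one]
  rw [Finset.sum_map] at h2
  simp only [Function.Embedding.subtype_apply, h1, ENNReal.toReal_ofNat, Real.rpow_two] at h2
  refine le_trans ?_ (h2.trans (by gcongr))
  simp [sphereCard]

lemma eventually_decayBound_le {r : ℝ} (hr : 1 < r) :
    ∀ᶠ n : ℕ in atTop, (decayBound (2 * n) * 2 ^ 32 : ℝ) ≤ r ^ n := by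
  set K : ℝ := 4 * 137201 ^ 2 * (2 * 27441 ^ 5) ^ 6 * 2 ^ 32 with hK
  have h := (isLittleO_pow_const_const_pow_of_one_lt (R := ℝ) 32 hr).const_mul_left K
  filter_upwards [h.bound one_pos, eventually_ge_atTop 1] with n hn h1
  rw [one_mul, Real.norm_of_nonneg (by positivity), Real.norm_of_nonneg (by positivity)] at hn
  refine le_trans ?_ hn
  have h2 : (1 : ℝ) ≤ n := by exact_mod_cast h1
  calc (decayBound (2 * n) * 2 ^ 32 : ℝ)
      = 4 * (137200 * n + 1) ^ 2 * (2 * (27440 * n + 1) ^ 5) ^ 6 * 2 ^ 32 := by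
        rw [decayBound]
        push_cast
        ring
    _ ≤ 4 * (137201 * n) ^ 2 * (2 * (27441 * n) ^ 5) ^ 6 * 2 ^ 32 := by
        gcongr <;> linarith
    _ = K * n ^ 32 := by rw [hK]; ring

end DualB4

section Limsup

open Filter

variable {s t : ℕ → ℝ} {C : ℝ}

lemma rpow_one_div_le {x y : ℝ} {n : ℕ} (hn : n ≠ 0) (hx : 0 ≤ x) (hy : 0 ≤ y) (h : x ≤ y ^ n) :
    x ^ (1 / (n : ℝ)) ≤ y := by
  refine (Real.rpow_le_rpow hx h (by positivity)).trans_eq ?_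
  rw [one_div, Real.pow_rpow_inv_natCast hy hn]

lemma le_pow_of_rpow_one_div_le {x y : ℝ} {n : ℕ} (hn : n ≠ 0) (hx : 0 ≤ x)
    (h : x ^ (1 / (n : ℝ)) ≤ y) : x ≤ y ^ n := by
  rw [one_div] at h
  rw [← Real.rpow_inv_natCast_pow hx hn]
  have := Real.rpow_nonneg hx (n : ℝ)⁻¹
  gcongr

lemma isBoundedUnder_rpow (hs : ∀ n, 0 ≤ s n) (hC : 0 ≤ C) (h : ∀ᶠ n in atTop, s n ≤ C ^ n) :
    IsBoundedUnder (· ≤ ·) atTop fun n : ℕ => s n ^ (1 / (n : ℝ)) :=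
  ⟨C, by
    rw [eventually_map]
    filter_upwards [h, eventually_ne_atTop 0] with n hn h0
    exact rpow_one_div_le h0 (hs n) hC hn⟩

lemma isCoboundedUnder_rpow (hs : ∀ n, 0 ≤ s n) :
    IsCoboundedUnder (· ≤ ·) atTop fun n : ℕ => s n ^ (1 / (n : ℝ)) :=
  IsBoundedUnder.isCoboundedUnder_le
    ⟨0, eventually_map.2 (Eventually.of_forall fun n => Real.rpow_nonneg (hs n) _)⟩

lemma limsup_rpow_sq_eq (ht : ∀ n, 0 ≤ t n) (hs : ∀ n, 0 ≤ s n) (h1 : ∀ n, s n ≤ t n ^ 2)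
    (h2 : ∀ r : ℝ, 1 < r → ∀ᶠ n in atTop, t n ^ 2 ≤ r ^ n * s n) (hC : 0 ≤ C)
    (h3 : ∀ n, s n ≤ C ^ n) :
    limsup (fun n : ℕ => t n ^ (1 / (n : ℝ))) atTop ^ 2 =
      limsup (fun n : ℕ => s n ^ (1 / (n : ℝ))) atTop := by
  have ht2 : ∀ n, 0 ≤ t n ^ 2 := fun n => sq_nonneg _
  have bs := isBoundedUnder_rpow hs hC (Eventually.of_forall h3)
  have bt : IsBoundedUnder (· ≤ ·) atTop fun n : ℕ => (t n ^ 2) ^ (1 / (n : ℝ)) := by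
    refine isBoundedUnder_rpow (C := 2 * C) ht2 (by positivity) ?_
    filter_upwards [h2 2 one_lt_two] with n hn
    rw [mul_pow]
    exact hn.trans (by gcongr; exact h3 n)
  have hsqrt : (fun n : ℕ => t n ^ (1 / (n : ℝ))) =
      Real.sqrt ∘ fun n : ℕ => (t n ^ 2) ^ (1 / (n : ℝ)) := by
    funext n
    rw [Function.comp, ← Real.rpow_natCast, ← Real.rpow_mul (ht n), mul_comm, Real.rpow_mul (ht n),
      Real.rpow_natCast, Real.sqrt_sq (Real.rpow_nonneg (ht n) _)]
  have heq : limsup (fun n : ℕ => (t n ^ 2) ^ (1 / (n : ℝ))) atTop =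
      limsup (fun n : ℕ => s n ^ (1 / (n : ℝ))) atTop := by
    refine le_antisymm (le_of_forall_gt_imp_ge_of_dense fun y hy => ?_) ?_
    · obtain ⟨L, hL, hLy⟩ := exists_between hy
      have hev := eventually_lt_of_limsup_lt hL bs
      obtain ⟨k, hk⟩ := hev.exists
      have hL0 : 0 < L := (Real.rpow_nonneg (hs k) _).trans_lt hk
      refine limsup_le_of_le (isCoboundedUnder_rpow ht2) ?_
      filter_upwards [hev, h2 (y / L) ((one_lt_div hL0).2 hLy), eventually_ne_atTop 0]
        with n hn hn' h0
      refine rpow_one_div_le h0 (ht2 n) (hL0.trans hLy).le (hn'.trans ?_)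
      calc (y / L) ^ n * s n ≤ (y / L) ^ n * L ^ n := by
            gcongr
            · exact pow_nonneg (div_nonneg (hL0.trans hLy).le hL0.le) n
            · exact le_pow_of_rpow_one_div_le h0 (hs n) hn.le
        _ = y ^ n := by rw [← mul_pow, div_mul_cancel₀ _ hL0.ne']
    · refine limsup_le_limsup (Eventually.of_forall fun n => ?_) (isCoboundedUnder_rpow hs) bt
      exact Real.rpow_le_rpow (hs n) (h1 n) (by positivity)
  have h0 : 0 ≤ limsup (fun n : ℕ => (t n ^ 2) ^ (1 / (n : ℝ))) atTop :=
    le_limsup_of_frequently_le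
      (Frequently.of_forall fun n => Real.rpow_nonneg (ht2 n) _) bt
  rw [hsqrt, ← Monotone.map_limsup_of_continuousAt Real.sqrt_monotone _
    Real.continuous_sqrt.continuousAt bt (isCoboundedUnder_rpow ht2), Real.sq_sqrt h0, heq]

lemma one_lt_limsup_rpow (hs : ∀ n, 0 ≤ s n) (hC : 0 ≤ C) (h3 : ∀ n, s n ≤ C ^ n)
    (h : ∀ n : ℕ, 2 ^ n ≤ ∑ m ∈ Finset.range (3 * n + 1), s m) :
    1 < limsup (fun n : ℕ => s n ^ (1 / (n : ℝ))) atTop := by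
  by_contra! hle
  have h1 := eventually_lt_of_limsup_lt (hle.trans_lt (by norm_num : (1 : ℝ) < 1.1))
    (isBoundedUnder_rpow hs hC (Eventually.of_forall h3))
  obtain ⟨N, hN⟩ := eventually_atTop.1 h1
  obtain ⟨K, hK, hsK⟩ : ∃ K : ℝ, 0 < K ∧ ∀ n, s n ≤ K * 1.1 ^ n := by
    have h0 : 0 ≤ ∑ m ∈ Finset.range (N + 1), s m := Finset.sum_nonneg fun m _ => hs m
    refine ⟨1 + ∑ m ∈ Finset.range (N + 1), s m, by positivity, fun n => ?_⟩
    have h2 : (1 : ℝ) ≤ 1.1 ^ n := one_le_pow₀ (by norm_num)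
    rcases lt_or_ge n (N + 1) with hn | hn
    · have := Finset.single_le_sum (f := s) (fun m _ => hs m) (Finset.mem_range.2 hn)
      nlinarith
    · have := le_pow_of_rpow_one_div_le (by omega) (hs n) (hN n (by omega)).le
      nlinarith
  have h2 : ∀ n : ℕ, (2 : ℝ) ^ n ≤ K * ((3 * n + 1) * 1.331 ^ n) := fun n => by
    calc (2 : ℝ) ^ n ≤ ∑ m ∈ Finset.range (3 * n + 1), s m := h n
      _ ≤ ∑ m ∈ Finset.range (3 * n + 1), K * 1.1 ^ (3 * n) := by
        refine Finset.sum_le_sum fun m hm => (hsK m).trans ?_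
        gcongr
        · norm_num
        · have := Finset.mem_range.1 hm
          omega
      _ = _ := by
        rw [Finset.sum_const, Finset.card_range, nsmul_eq_mul, pow_mul]
        push_cast
        norm_num
        ring
  have h4 := (isLittleO_coe_const_pow_of_one_lt (R := ℝ) (r := 1.5) (by norm_num)).bound
    (c := 1 / (5 * K)) (by positivity)
  obtain ⟨n, hn, hn1⟩ := (h4.and (eventually_ge_atTop 1)).exists
  rw [Real.norm_of_nonneg (by positivity), Real.norm_of_nonneg (by positivity)] at hn
  have hn2 : (1 : ℝ) ≤ n := by exact_mod_cast hn1
  have h5 : (2 : ℝ) ^ n ≤ 4 / 5 * 2 ^ n := by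
    calc (2 : ℝ) ^ n ≤ K * ((3 * n + 1) * 1.331 ^ n) := h2 n
      _ ≤ K * ((4 * (1 / (5 * K) * 1.5 ^ n)) * 1.331 ^ n) := by
        gcongr
        linarith
      _ = 4 / 5 * (1.5 * 1.331) ^ n := by
        rw [mul_pow]
        field_simp
      _ ≤ 4 / 5 * 2 ^ n := by
        gcongr
        norm_num
  have : (0 : ℝ) < 2 ^ n := by positivity
  linarith

end Limsup

/-- Let `sₙ` be the cardinality of the sphere of radius `n` in `B₄` (word length
with respect to `{a,b,c}`), and let `Tₙ` be the operator on `ℓ²(B₄)` of left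
convolution by the characteristic function of that sphere. Then
`(limsup ‖Tₙ‖^{1/n})² = limsup sₙ^{1/n}` and `limsup sₙ^{1/n} > 1`; i.e. with
`ρ_r` and `ρ` the radii of convergence of `Σ ‖Tₙ‖ zⁿ` and of the growth series
`Σ sₙ zⁿ`, one has `ρ_r = √ρ < 1`. -/
theorem B4_radius_of_convergence
    (T : ℕ → (lp (fun _ : B4 => ℂ) 2 →L[ℂ] lp (fun _ : B4 => ℂ) 2))
    (hT : ∀ (n : ℕ) (ξ : lp (fun _ : B4 => ℂ) 2) (g : B4),
      (T n) ξ g = ∑' x : {x : B4 // wordLength SB4 x = n}, ξ ((x : B4)⁻¹ * g)) :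
    (Filter.limsup (fun n : ℕ => ‖T n‖ ^ (1 / (n : ℝ))) Filter.atTop) ^ 2 =
      Filter.limsup (fun n : ℕ => (sphereCard n : ℝ) ^ (1 / (n : ℝ))) Filter.atTop ∧
    1 < Filter.limsup (fun n : ℕ => (sphereCard n : ℝ) ^ (1 / (n : ℝ))) Filter.atTop := by
  have hC : (0 : ℝ) ≤ Nat.card DualB4.Letter := Nat.cast_nonneg _
  have hs : ∀ n, (0 : ℝ) ≤ sphereCard n := fun n => Nat.cast_nonneg _
  have h3 : ∀ n, (sphereCard n : ℝ) ≤ (Nat.card DualB4.Letter : ℝ) ^ n := fun n => by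
    exact_mod_cast DualB4.sphereCard_le n
  refine ⟨limsup_rpow_sq_eq (fun n => norm_nonneg _) hs
    (fun n => DualB4.sphereCard_le_opNorm_sq (hT n)) (fun r hr => ?_) hC h3,
    one_lt_limsup_rpow hs hC h3 fun n => by exact_mod_cast DualB4.two_pow_le_sum n⟩
  filter_upwards [DualB4.eventually_decayBound_le hr] with n hn
  exact (DualB4.opNorm_sq_le (hT n)).trans (by gcongr)
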